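/- Suppose k ≥ 3 and 1 ≤ ℓ ≤ k−1 is such that (k−ℓ) does not divide k. Then there exists an integer b with k ≤ b ≤ k⁴ such that for every μ > 0 there exist constants 0 < α < c < γ < μ and an integer n₀ with the following property. Let H be a k-graph of order n ≥ n₀ with minimum degree δ(H) ≥ μn, and call a set S of k−ℓ vertices of H c-good if H contains at least c·n^b absorbing ℓ-paths for S, each on exactly b vertices. Then H contains an ℓ-path P on at most μn vertices, with ordered ends P^beg and P^end, such that: (1) every vertex of H not in V(P) lies in at most γn^{k−ℓ−1} (k−ℓ)-sets of vertices of H that are not c-good; (2) for any collection S_1,…,S_r of at most αn pairwise disjoint c-good (k−ℓ)-sets of vertices of H − V(P), H contains an ℓ-path Q with the same ordered ends P^beg and P^end and with V(Q) = V(P) ∪ S_1 ∪ … ∪ S_r. -/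

import Mathlib

open Finset

/-- `H` is (the edge set of) a `k`-uniform hypergraph on vertex set `Fin n`. -/
def IsKGraph (n k : ℕ) (H : Finset (Finset (Fin n))) : Prop := ∀ e ∈ H, e.card = k

/-- The degree of a vertex set `A` in `H`: the number of edges containing `A`. -/
def degree (n : ℕ) (H : Finset (Finset (Fin n))) (A : Finset (Fin n)) : ℕ :=
  (H.filter (fun e => A ⊆ e)).card

/-- The minimum `(k-1)`-degree of `H` is at least `x`. -/
def MinDegreeGe (n k : ℕ) (H : Finset (Finset (Fin n))) (x : ℝ) : Prop :=
  ∀ A : Finset (Fin n), A.card = k - 1 → x ≤ (degree n H A : ℝ)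

/-- The edge of an `ℓ`-path starting at position `s * (k - ℓ)` of the vertex
sequence `v`: it consists of the `k` consecutive vertices from that position. -/
def pathEdge (k ℓ : ℕ) {α : Type*} [DecidableEq α] (v : ℕ → α) (s : ℕ) : Finset α :=
  (Finset.range k).image (fun t => v (s * (k - ℓ) + t))

/-- `v` (restricted to its first `r` values) is a vertex sequence of an `ℓ`-path
all of whose edges satisfy the edge predicate `E`. -/
def IsPathSeq (k ℓ r : ℕ) {α : Type*} [DecidableEq α] (E : Finset α → Prop) (v : ℕ → α) : Prop :=
  k ≤ r ∧ (k - ℓ) ∣ (r - k) ∧ Set.InjOn v (Set.Iio r) ∧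
    ∀ s : ℕ, s * (k - ℓ) + k ≤ r → E (pathEdge k ℓ v s)

/-- `u` is the vertex sequence of an `ℓ`-path on `r` vertices in `H` which is
absorbing for the `(k-ℓ)`-set `S`. -/
def IsAbsorbingSeq (n k ℓ r : ℕ) (H : Finset (Finset (Fin n)))
    (S : Finset (Fin n)) (u : ℕ → Fin n) : Prop :=
  IsPathSeq k ℓ r (· ∈ H) u ∧ (∀ i < r, u i ∉ S) ∧
  ∃ w : ℕ → Fin n, IsPathSeq k ℓ (r + (k - ℓ)) (· ∈ H) w ∧
    (Finset.range (r + (k - ℓ))).image w = (Finset.range r).image u ∪ S ∧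
    (∀ i < ℓ, w i = u i) ∧
    (∀ i < ℓ, w (r + (k - ℓ) - ℓ + i) = u (r - ℓ + i))

open scoped Classical in
/-- The `(k-ℓ)`-set `S` is `c`-good: `H` contains at least `c n^b` absorbing
`ℓ`-paths for `S` on `b` vertices (counted as vertex sequences of length `b`). -/
def CGood (n k ℓ b : ℕ) (H : Finset (Finset (Fin n))) (c : ℝ)
    (S : Finset (Fin n)) : Prop :=
  c * (n : ℝ) ^ b ≤
    (((Finset.univ : Finset (Fin b → Fin n)).filter
      (fun v => ∃ u : ℕ → Fin n, (∀ i : Fin b, u (i : ℕ) = v i) ∧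
        IsAbsorbingSeq n k ℓ b H S u)).card : ℝ)

open Finset
namespace AbsPath

/-- swap `i` and `i+1` -/
def swp (i r : ℕ) : ℕ := if r = i then i + 1 else if r = i + 1 then i else r

/-- A word over the letters `0,…,k-1`, given as `P t % k`, obtained from the periodic word by a
rearrangement `P` of positions. -/
structure Reach (k d m : ℕ) (τ : ℕ → ℕ) (P : ℕ → ℕ) : Prop where
  inj : Function.Injective P
  start : ∀ t < k, P t = t
  pres : ∀ K t, k ∣ K → t < K → P t < K
  block : ∀ s, (range d).image (fun j => P (s*d+k+j) % k) = (range d).image (fun j => P (s*d+j) % k)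
  tail : ∀ t, m*k*d ≤ t → P t % k = τ (t % k)

/-- the position rearrangement -/
def posSwap (k T i t : ℕ) : ℕ :=
  if t < T then t else if t % k = i then t + 1 else if t % k = i + 1 then t - 1 else t

lemma mod_succ_of {k i t : ℕ} (hi : i + 1 < k) (h : t % k = i) : (t + 1) % k = i + 1 := by
  rw [Nat.add_mod, h, Nat.mod_eq_of_lt (show 1 < k by omega), Nat.mod_eq_of_lt hi]

lemma mod_pred_of {k i t : ℕ} (hi : i + 1 < k) (h : t % k = i + 1) : (t - 1) % k = i ∧ 1 ≤ t := by
  have h1 := Nat.div_add_mod t k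
  have h2 : t - 1 = i + k * (t / k) := by omega
  rw [h2, Nat.add_mul_mod_self_left, Nat.mod_eq_of_lt (by omega)]
  exact ⟨rfl, by omega⟩

lemma posSwap_invol {k T i : ℕ} (hi : i + 1 < k) (hT : T % k ≠ i + 1) :
    Function.Involutive (posSwap k T i) := by
  intro t
  unfold posSwap
  by_cases h1 : t < T
  · simp [h1]
  by_cases h2 : t % k = i
  · have := mod_succ_of hi h2
    simp only [h1, h2, if_true, if_false, this]
    rw [if_neg (by omega), if_neg (by omega)]; omega
  by_cases h3 : t % k = i + 1
  · obtain ⟨h4, h5⟩ := mod_pred_of hi h3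
    have : t ≠ T := by rintro rfl; exact hT h3
    have e : (if t < T then t else if t % k = i then t + 1 else if t % k = i + 1 then t - 1 else t)
        = t - 1 := by rw [if_neg h1, if_neg h2, if_pos h3]
    rw [e, if_neg (by omega : ¬ t - 1 < T), if_pos h4]
    omega
  · simp [h1, h2, h3]

lemma posSwap_ge {k T i t : ℕ} (hT : T % k ≠ i + 1) (h : T ≤ t) :
    T ≤ posSwap k T i t := by
  unfold posSwap
  split_ifs with h1 h2 h3
  · exact h
  · omega
  · have : t ≠ T := by rintro rfl; exact hT h3
    omega
  · exact h

lemma posSwap_mod {k T i t : ℕ} (hi : i + 1 < k) (h : T ≤ t) :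
    posSwap k T i t % k = swp i (t % k) := by
  unfold posSwap swp
  rw [if_neg (by omega)]
  split_ifs with h2 h3
  · exact mod_succ_of hi h2
  · exact (mod_pred_of hi h3).1
  · rfl

lemma posSwap_lt {k T i t K : ℕ} (hi : i + 1 < k) (hK : k ∣ K) (h : t < K) :
    posSwap k T i t < K := by
  unfold posSwap
  split_ifs with h1 h2 h3
  · exact h
  · have h4 := mod_succ_of hi h2
    rcases Nat.lt_or_ge (t+1) K with h5 | h5
    · exact h5
    · exfalso
      have : t + 1 = K := by omega
      rw [this, Nat.mod_eq_zero_of_dvd hK] at h4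
      omega
  · omega
  · exact h

lemma swp_res {k i e q u : ℕ} (hi : i + 1 < k) (he : e ≤ i) (hu : u < k) :
    swp i ((k*q + (i - e) + u) % k) = (k*q + (i-e) + swp e u) % k := by
  have h1 : ∀ v, (k*q + (i - e) + v) % k = ((i - e) + v) % k := by
    intro v; rw [add_assoc, Nat.mul_add_mod]
  rw [h1, h1]
  unfold swp
  by_cases hue : u = e
  · subst hue
    rw [if_pos (show u = u from rfl), show i - u + u = i by omega, Nat.mod_eq_of_lt (by omega : i < k),
      if_pos rfl, show i - u + (u+1) = i + 1 by omega, Nat.mod_eq_of_lt hi]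
  by_cases hue2 : u = e + 1
  · subst hue2
    rw [if_neg (by omega : ¬ e + 1 = e), if_pos (rfl : e+1 = e+1), show i - e + (e+1) = i+1 by omega,
      show i - e + e = i by omega, Nat.mod_eq_of_lt hi, if_neg (by omega), if_pos rfl,
      Nat.mod_eq_of_lt (by omega : i < k)]
  · rw [if_neg hue, if_neg hue2]
    rcases Nat.lt_or_ge (i - e + u) k with h | h
    · rw [Nat.mod_eq_of_lt h, if_neg (by omega), if_neg (by omega)]
    · rw [Nat.mod_eq_sub_mod h, Nat.mod_eq_of_lt (by omega), if_neg (by omega), if_neg (by omega)]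

lemma exists_s0 {k d : ℕ} (hd : 0 < d) (hdk : d < k) (i m : ℕ) (hi : i + 1 < k) :
    ∃ s0 q, m * k ≤ s0 ∧ s0 < m*k + k ∧ s0 * d = k * q + (i - i % Nat.gcd d k) := by
  have hg : Nat.gcd d k ≤ d := Nat.gcd_le_left _ hd
  obtain ⟨x, -, hx⟩ := Nat.exists_mul_mod_eq_gcd (k := k) (n := d) (by omega)
  set g := Nat.gcd d k
  have h1 : (d * (x * (i / g))) % k = i - i % g := by
    have h2 : g * (i / g) = i - i % g := by
      have := Nat.div_add_mod i g; omega
    rw [← mul_assoc, Nat.mul_mod, hx, ← Nat.mul_mod_mod, ]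
    have : g * (i / g % k) % k = g * (i / g) % k := by rw [Nat.mul_mod_mod]
    simp only [Nat.mod_mod, this]
    rw [h2, Nat.mod_eq_of_lt (by omega)]
  refine ⟨m * k + (x * (i/g)) % k, ((m * k + (x * (i/g)) % k) * d) / k, by omega,
    by have := Nat.mod_lt (x * (i/g)) (by omega : 0 < k); omega, ?_⟩
  have h3 : ((m * k + (x * (i/g)) % k) * d) % k = i - i % g := by
    rw [← h1, mul_comm d, Nat.mul_mod, mul_comm m k, Nat.mul_add_mod, Nat.mod_mod, ← Nat.mul_mod]
  rw [← h3]
  exact (Nat.div_add_mod _ _).symm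

lemma Reach.step {k d m : ℕ} {τ P : ℕ → ℕ} (hd : 0 < d) (hdk : d < k) (hnd : ¬ d ∣ k)
    (h : Reach k d m τ P) {i : ℕ} (hi : i + 1 < k) :
    ∃ P', Reach k d (m+1) (fun r => τ (swp i r)) P' := by
  obtain ⟨s0, q, hs1, hs2, hs3⟩ := exists_s0 hd hdk i m hi
  have hgd : Nat.gcd d k < d := by
    refine lt_of_le_of_ne (Nat.gcd_le_left _ hd) ?_
    intro h; exact hnd (h ▸ Nat.gcd_dvd_right d k)
  have hgpos : 0 < Nat.gcd d k := Nat.gcd_pos_of_pos_left _ hd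
  set e := i % Nat.gcd d k with he
  have he1 : e < Nat.gcd d k := Nat.mod_lt _ hgpos
  have he2 : e ≤ i := Nat.mod_le _ _
  have hTm : (k + s0 * d) % k ≠ i + 1 := by
    rw [Nat.add_mod_left, hs3, Nat.mul_add_mod, Nat.mod_eq_of_lt (by omega)]; omega
  set T := k + s0 * d with hT
  have hmk : m * k * d ≤ s0 * d := Nat.mul_le_mul_right _ hs1
  have hbig : ∀ t, T ≤ t → P (posSwap k T i t) % k = τ (swp i (t % k)) := by
    intro t ht
    rw [h.tail _ (by have := posSwap_ge hTm ht; omega), posSwap_mod hi ht]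
  have hsmall : ∀ t, t < T → posSwap k T i t = t := by
    intro t ht; simp [posSwap, ht]
  -- periodicity after the swap
  have hper : ∀ t, s0 * d + d ≤ t → P (posSwap k T i t) % k = τ (swp i (t % k)) := by
    intro t ht
    rcases Nat.lt_or_ge t T with h1 | h1
    · rw [hsmall t h1, h.tail t (by omega)]
      congr 1
      obtain ⟨u, rfl⟩ : ∃ u, t = s0 * d + u := ⟨t - s0 * d, by omega⟩
      rw [hs3, swp_res hi he2 (by omega)]
      congr 2
      unfold swp
      rw [if_neg (by omega), if_neg (by omega)]
    · exact hbig t h1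
  refine ⟨fun t => P (posSwap k T i t), ?_, ?_, ?_, ?_, ?_⟩
  · exact h.inj.comp (posSwap_invol hi hTm).injective
  · intro t ht
    show P (posSwap k T i t) = t
    rw [hsmall t (by omega), h.start t ht]
  · intro K t hK ht
    exact h.pres K _ hK (posSwap_lt hi hK ht)
  · intro s
    rcases lt_trichotomy s s0 with h1 | h1 | h1
    · have h2 : s * d + d ≤ s0 * d := by
        have := Nat.mul_le_mul_right d (Nat.succ_le_of_lt h1); rw [Nat.succ_mul] at this; exact this
      have h3 := h.block s
      convert h3 using 1
      · apply image_congr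
        intro j hj
        have hj := mem_range.1 (mem_coe.1 hj)
        show P (posSwap k T i _) % k = _
        rw [hsmall _ (by omega)]
      · apply image_congr
        intro j hj
        have hj := mem_range.1 (mem_coe.1 hj)
        show P (posSwap k T i _) % k = _
        rw [hsmall _ (by omega)]
    · subst h1
      have e1 : ∀ j < d, P (posSwap k T i (s*d+k+j)) % k = τ ((s*d + swp e j) % k) := by
        intro j hj
        rw [hbig _ (by omega), show s*d+k+j = s*d + j + k by ring, Nat.add_mod_right, hs3,
          swp_res hi he2 (by omega)]
      have e2 : ∀ j < d, P (posSwap k T i (s*d+j)) % k = τ ((s*d + j) % k) := by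
        intro j hj
        rw [hsmall _ (by omega), h.tail _ (by omega)]
      have hsw : ∀ j < d, swp e j < d := by
        intro j hj; unfold swp; split_ifs <;> omega
      have hsw2 : ∀ j, swp e (swp e j) = j := by
        intro j; unfold swp; split_ifs <;> omega
      ext x
      simp only [mem_image, mem_range]
      constructor
      · rintro ⟨j, hj, rfl⟩
        exact ⟨swp e j, hsw j hj, by rw [e1 j hj, e2 _ (hsw j hj)]⟩
      · rintro ⟨j, hj, rfl⟩
        exact ⟨swp e j, hsw j hj, by rw [e1 _ (hsw j hj), e2 _ hj, hsw2]⟩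
    · have h2 : s0 * d + d ≤ s * d := by
        have := Nat.mul_le_mul_right d (Nat.succ_le_of_lt h1); rw [Nat.succ_mul] at this; exact this
      apply image_congr
      intro j hj
      have hj := mem_range.1 (mem_coe.1 hj)
      show P (posSwap k T i _) % k = P (posSwap k T i _) % k
      rw [hper _ (by omega), hper _ (by omega), show s*d+k+j = s*d + j + k by ring, Nat.add_mod_right]
  · intro t ht
    apply hper
    have : (s0 + 1) * d ≤ (m+1)*k*d := Nat.mul_le_mul_right _ (by rw [Nat.add_mul, Nat.one_mul]; omega)
    rw [Nat.add_mul, Nat.one_mul] at this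
    omega

lemma Reach.congr {k d m : ℕ} {τ τ' P : ℕ → ℕ} (hk : 0 < k) (h : Reach k d m τ P)
    (hτ : ∀ r < k, τ r = τ' r) : Reach k d m τ' P :=
  ⟨h.inj, h.start, h.pres, h.block, fun t ht => by rw [h.tail t ht, hτ _ (Nat.mod_lt _ hk)]⟩

lemma Reach.rot1 {k d m : ℕ} {τ P : ℕ → ℕ} (hd : 0 < d) (hdk : d < k) (hnd : ¬ d ∣ k)
    (h : Reach k d m τ P) :
    ∃ P', Reach k d (m+(k-1)) (fun r => τ ((r+1) % k)) P' := by
  have key : ∀ j, j < k → ∃ P', Reach k d (m + j)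
      (fun r => τ (if r < j then r + 1 else if r = j then 0 else r)) P' := by
    intro j
    induction j with
    | zero =>
      intro _
      refine ⟨P, h.congr (by omega) ?_⟩
      intro r _
      simp only [Nat.not_lt_zero, if_false]
      split_ifs with h0
      · rw [h0]
      · rfl
    | succ j ih =>
      intro hj
      obtain ⟨P1, h1⟩ := ih (by omega)
      obtain ⟨P2, h2⟩ := h1.step hd hdk hnd (i := j) hj
      refine ⟨P2, h2.congr (by omega) ?_⟩
      intro r _
      refine congrArg τ ?_
      unfold swp
      split_ifs <;> omega
  obtain ⟨P', h'⟩ := key (k-1) (by omega)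
  refine ⟨P', h'.congr (by omega) ?_⟩
  intro r hr
  refine congrArg τ ?_
  rcases Nat.lt_or_ge r (k-1) with h1 | h1
  · rw [if_pos h1, Nat.mod_eq_of_lt (by omega)]
  · rw [if_neg (by omega), if_pos (by omega), show r + 1 = k by omega, Nat.mod_self]

lemma exists_reach {k d : ℕ} (hd : 0 < d) (hdk : d < k) (hnd : ¬ d ∣ k) (a : ℕ) :
    ∃ P, Reach k d (a*(k-1)) (fun r => (r+a) % k) P := by
  induction a with
  | zero =>
    refine ⟨fun t => t, fun _ _ h => h, fun _ _ => rfl, fun _ _ _ h => h, ?_, ?_⟩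
    · intro s
      apply image_congr
      intro j _
      show (s*d+k+j) % k = (s*d+j) % k
      rw [show s*d+k+j = s*d + j + k by ring, Nat.add_mod_right]
    · intro t _
      simp
  | succ a ih =>
    obtain ⟨P, h⟩ := ih
    obtain ⟨P', h'⟩ := h.rot1 hd hdk hnd
    refine ⟨P', ?_⟩
    have : (a+1)*(k-1) = a*(k-1) + (k-1) := by ring
    rw [this]
    refine h'.congr (by omega) ?_
    intro r _
    simp only [Nat.mod_add_mod]
    congr 1; ring

/-- every window is rainbow -/
lemma Reach.window {k d m : ℕ} {τ P : ℕ → ℕ} (hdk : d < k)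
    (h : Reach k d m τ P) (s : ℕ) :
    (range k).image (fun t => P (s*d+t) % k) = range k := by
  induction s with
  | zero =>
    ext x
    simp only [mem_image, mem_range, Nat.zero_mul, Nat.zero_add]
    constructor
    · rintro ⟨t, ht, rfl⟩
      exact Nat.mod_lt _ (by omega)
    · intro hx
      exact ⟨x, hx, by rw [h.start x hx, Nat.mod_eq_of_lt hx]⟩
  | succ s ih =>
    refine Eq.trans ?_ ih
    have hb := h.block s
    ext x
    have hb' := congrArg (fun A => x ∈ A) hb
    simp only [mem_image, mem_range, eq_iff_iff] at hb' ⊢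
    have hss : (s+1)*d = s*d + d := Nat.succ_mul s d
    constructor
    · rintro ⟨t, ht, rfl⟩
      rcases Nat.lt_or_ge (t + d) k with h1 | h1
      · exact ⟨t + d, h1, by congr 2; ring⟩
      · obtain ⟨j, hj, hj2⟩ := hb'.1 ⟨t + d - k, by omega, by
          congr 2
          have hss : (s+1)*d = s*d + d := Nat.succ_mul s d
          omega⟩
        exact ⟨j, by omega, hj2⟩
    · rintro ⟨t, ht, rfl⟩
      rcases Nat.lt_or_ge t d with h1 | h1
      · obtain ⟨j, hj, hj2⟩ := hb'.2 ⟨t, h1, rfl⟩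
        refine ⟨k - d + j, by omega, ?_⟩
        rw [← hj2]
        congr 2
        have hss : (s+1)*d = s*d + d := Nat.succ_mul s d
        omega
      · refine ⟨t - d, by omega, ?_⟩
        congr 2
        have hss : (s+1)*d = s*d + d := Nat.succ_mul s d
        omega

end AbsPath

open Finset
namespace AbsPath

/-- a path sequence without the injectivity requirement -/
def IsWalk (k ℓ r : ℕ) {α : Type*} [DecidableEq α] (E : Finset α → Prop) (v : ℕ → α) : Prop :=
  k ≤ r ∧ (k - ℓ) ∣ (r - k) ∧ ∀ s : ℕ, s * (k - ℓ) + k ≤ r → E (pathEdge k ℓ v s)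

lemma isPathSeq_iff {k ℓ r : ℕ} {α : Type*} [DecidableEq α] {E : Finset α → Prop} {v : ℕ → α} :
    IsPathSeq k ℓ r E v ↔ IsWalk k ℓ r E v ∧ Set.InjOn v (Set.Iio r) := by
  unfold IsPathSeq IsWalk; tauto

/-- concatenation with overlap `ℓ` -/
def glue {α : Type*} (r ℓ : ℕ) (v w : ℕ → α) (i : ℕ) : α := if i < r then v i else w (i - (r - ℓ))

section
variable {α : Type*} {r r' ℓ k : ℕ} {v w : ℕ → α}

lemma glue_left {i : ℕ} (h : i < r) : glue r ℓ v w i = v i := by simp [glue, h]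

lemma glue_right (hr : ℓ ≤ r) (hvw : ∀ i < ℓ, w i = v (r - ℓ + i)) {i : ℕ} (h : r - ℓ ≤ i) :
    glue r ℓ v w i = w (i - (r - ℓ)) := by
  unfold glue
  split_ifs with h1
  · rw [hvw _ (by omega)]; congr 1; omega
  · rfl

lemma glue_last (hr : ℓ ≤ r) (hr' : ℓ ≤ r') (hvw : ∀ i < ℓ, w i = v (r - ℓ + i)) {i : ℕ} :
    glue r ℓ v w (r + r' - ℓ - ℓ + i) = w (r' - ℓ + i) := by
  rw [glue_right hr hvw (by omega)]; congr 1; omega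

variable [DecidableEq α]

lemma pathEdge_congr {v w : ℕ → α} {s s' : ℕ}
    (h : ∀ t < k, v (s * (k - ℓ) + t) = w (s' * (k-ℓ) + t)) :
    pathEdge k ℓ v s = pathEdge k ℓ w s' := by
  unfold pathEdge
  apply image_congr
  intro t ht
  exact h t (mem_range.1 (mem_coe.1 ht))

lemma IsWalk.glue {E : Finset α → Prop} (hlk : ℓ < k)
    (hv : IsWalk k ℓ r E v) (hw : IsWalk k ℓ r' E w)
    (hvw : ∀ i < ℓ, w i = v (r - ℓ + i)) : IsWalk k ℓ (r + r' - ℓ) E (glue r ℓ v w) := by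
  obtain ⟨h1, h2, h3⟩ := hv
  obtain ⟨h4, h5, h6⟩ := hw
  obtain ⟨p, hp⟩ := h2
  obtain ⟨p', hp'⟩ := h5
  refine ⟨by omega, ⟨p + p' + 1, ?_⟩, ?_⟩
  · rw [Nat.mul_add, Nat.mul_add, ← hp, ← hp']; omega
  · intro s hs
    rcases Nat.lt_or_ge r (s * (k-ℓ) + k) with h | h
    · have hps : p < s := by
        by_contra hc
        have : s * (k-ℓ) ≤ (k-ℓ) * p := by rw [mul_comm]; exact Nat.mul_le_mul_left _ (by omega)
        omega
      obtain ⟨u, rfl⟩ : ∃ u, s = p + 1 + u := ⟨s - p - 1, by omega⟩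
      have hr : r - ℓ = (p+1) * (k-ℓ) := by rw [Nat.add_mul, mul_comm, ← hp]; omega
      have hexp : (p + 1 + u) * (k-ℓ) = (r - ℓ) + u * (k-ℓ) := by rw [hr]; ring
      have := h6 u (by omega)
      rw [show pathEdge k ℓ (AbsPath.glue r ℓ v w) (p+1+u) = pathEdge k ℓ w u from ?_]
      · exact this
      · apply pathEdge_congr
        intro t ht
        rw [glue_right (by omega) hvw (by omega)]
        congr 1; omega
    · rw [show pathEdge k ℓ (AbsPath.glue r ℓ v w) s = pathEdge k ℓ v s from ?_]
      · exact h3 s h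
      · apply pathEdge_congr
        intro t ht
        rw [glue_left (by omega)]

lemma image_glue (hr : ℓ ≤ r) (hr' : ℓ ≤ r') (hvw : ∀ i < ℓ, w i = v (r - ℓ + i)) :
    (range (r + r' - ℓ)).image (glue r ℓ v w) = (range r).image v ∪ (range r').image w := by
  ext x
  simp only [mem_image, mem_union, mem_range]
  constructor
  · rintro ⟨i, hi, rfl⟩
    rcases Nat.lt_or_ge i r with h | h
    · left; exact ⟨i, h, (glue_left h).symm⟩
    · right; exact ⟨i - (r - ℓ), by omega, (glue_right hr hvw (by omega)).symm⟩
  · rintro (⟨i, hi, rfl⟩ | ⟨i, hi, rfl⟩)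
    · exact ⟨i, by omega, glue_left hi⟩
    · refine ⟨i + (r - ℓ), by omega, ?_⟩
      rw [glue_right hr hvw (by omega)]; congr 1; omega

lemma IsPathSeq.glue {E : Finset α → Prop} (hlk : ℓ < k)
    (hv : IsPathSeq k ℓ r E v) (hw : IsPathSeq k ℓ r' E w)
    (hvw : ∀ i < ℓ, w i = v (r - ℓ + i))
    (hdis : ∀ i < r, ∀ j, ℓ ≤ j → j < r' → v i ≠ w j) :
    IsPathSeq k ℓ (r + r' - ℓ) E (glue r ℓ v w) := by
  rw [isPathSeq_iff] at hv hw ⊢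
  have hr : k ≤ r := hv.1.1
  have hr' : k ≤ r' := hw.1.1
  refine ⟨hv.1.glue hlk hw.1 hvw, ?_⟩
  intro i hi j hj hij
  simp only [Set.mem_Iio] at hi hj
  rcases Nat.lt_or_ge i r with h1 | h1 <;> rcases Nat.lt_or_ge j r with h2 | h2
  · rw [glue_left h1, glue_left h2] at hij
    exact hv.2 h1 h2 hij
  · rw [glue_left h1, glue_right (by omega) hvw (by omega)] at hij
    exact absurd hij (hdis i h1 _ (by omega) (by omega))
  · rw [glue_left h2, glue_right (by omega) hvw (by omega)] at hij
    exact absurd hij.symm (hdis j h2 _ (by omega) (by omega))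
  · rw [glue_right (by omega) hvw (by omega), glue_right (by omega) hvw (by omega)] at hij
    have := hw.2 (show i - (r - ℓ) < r' by omega) (show j - (r-ℓ) < r' by omega) hij
    omega

lemma IsWalk.reverse {E : Finset α → Prop} (hv : IsWalk k ℓ r E v) :
    IsWalk k ℓ r E (fun i => v (r - 1 - i)) := by
  obtain ⟨h1, ⟨p, hp⟩, h3⟩ := hv
  refine ⟨h1, ⟨p, hp⟩, ?_⟩
  intro s hs
  rcases Nat.eq_zero_or_pos (k-ℓ) with h0 | h0
  · -- degenerate case
    have h4 := h3 0 (by omega)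
    rw [h0] at hp hs
    rw [show pathEdge k ℓ (fun i => v (r-1-i)) s = pathEdge k ℓ v 0 from ?_]
    · exact h4
    · unfold pathEdge
      rw [h0]
      ext x
      simp only [mem_image, mem_range, Nat.mul_zero, Nat.zero_add]
      constructor
      · rintro ⟨t, ht, rfl⟩; exact ⟨r-1-t, by omega, rfl⟩
      · rintro ⟨t, ht, rfl⟩; exact ⟨r-1-t, by omega, by congr 1; omega⟩
  have hsp : s ≤ p := by
    by_contra hc
    have : (k-ℓ) * (p+1) ≤ s * (k-ℓ) := by rw [mul_comm]; exact Nat.mul_le_mul_right _ (by omega)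
    rw [Nat.mul_add] at this
    omega
  have hexp : (p - s) * (k-ℓ) + s * (k-ℓ) + k = r := by
    rw [← Nat.add_mul, Nat.sub_add_cancel hsp, mul_comm, ← hp]; omega
  have h4 := h3 (p - s) (by omega)
  rw [show pathEdge k ℓ (fun i => v (r-1-i)) s = pathEdge k ℓ v (p-s) from ?_]
  · exact h4
  · unfold pathEdge
    ext x
    simp only [mem_image, mem_range]
    constructor
    · rintro ⟨t, ht, rfl⟩; exact ⟨k-1-t, by omega, by congr 1; omega⟩
    · rintro ⟨t, ht, rfl⟩; exact ⟨k-1-t, by omega, by congr 1; omega⟩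

end

lemma rot_word {k ℓ : ℕ} (hl : 0 < ℓ) (hlk : ℓ < k) (hnd : ¬ (k-ℓ) ∣ k) (a : ℕ) (σ : ℕ → ℕ) :
    ∃ r v, IsWalk k ℓ r (· = (range k).image σ) v ∧ (∀ t < k, v t = σ t) ∧
      (∀ i < ℓ, v (r - ℓ + i) = σ ((k - ℓ + i + a) % k)) ∧
      ∀ t, ∃ j < k, v t = σ j := by
  obtain ⟨P, hP⟩ := exists_reach (k := k) (d := k-ℓ) (by omega) (by omega) hnd a
  set m := a * (k-1)
  refine ⟨k + m*k*(k-ℓ), fun t => σ (P t % k), ⟨by omega, ⟨m*k, ?_⟩, ?_⟩, ?_, ?_, ?_⟩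
  · rw [Nat.add_sub_cancel_left]; ring
  · intro s _
    have h := congrArg (fun A => A.image σ) (hP.window (by omega) s)
    simp only [image_image] at h
    exact h
  · intro t ht
    show σ (P t % k) = σ t
    rw [hP.start t ht, Nat.mod_eq_of_lt ht]
  · intro i hi
    show σ (P _ % k) = _
    rw [hP.tail _ (by omega)]
    congr 1
    rw [show k + m*k*(k-ℓ) - ℓ + i = k * (m * (k-ℓ)) + (k - ℓ + i) by
      have : k * (m * (k-ℓ)) = m*k*(k-ℓ) := by ring
      omega]
    rw [Nat.mul_add_mod, Nat.mod_add_mod]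
  · intro t
    exact ⟨P t % k, Nat.mod_lt _ (by omega), rfl⟩

/-- Templates: `k`-graphs on the letters `0..N-1`, the first `ρ` of them being roots. -/
structure Tmpl (k ρ N Q : ℕ) (E : ℕ → Finset ℕ) (top : ℕ → ℕ) : Prop where
  card : ∀ q < Q, (E q).card = k
  mem : ∀ q < Q, top q ∈ E q
  sub : ∀ q < Q, ∀ x ∈ E q, x ≤ top q
  ge : ∀ q < Q, ρ ≤ top q
  lt : ∀ q < Q, top q < N
  inj : ∀ q < Q, ∀ q' < Q, top q = top q' → q = q'

end AbsPath

open Finset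
namespace AbsPath

lemma IsWalk.mono {k ℓ r : ℕ} {α : Type*} [DecidableEq α] {E E' : Finset α → Prop} {v : ℕ → α}
    (h : IsWalk k ℓ r E v) (hE : ∀ e, E e → E' e) : IsWalk k ℓ r E' v :=
  ⟨h.1, h.2.1, fun s hs => hE _ (h.2.2 s hs)⟩

/-- letters of the chain growing out of the first root tuple -/
def wA (ℓ t : ℕ) : ℕ := if t < ℓ then t else t + ℓ
/-- letters of the chain growing out of the second root tuple -/
def wB (ℓ D t : ℕ) : ℕ := if t < ℓ then t + ℓ else t + D
/-- the two ends of the chains -/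
def wU (ℓ D t : ℕ) : ℕ := if t < ℓ then wA ℓ (D - ℓ + t) else wB ℓ D (D - 1 - (t - ℓ))
/-- letters of the `i`th middle edge -/
def wS (ℓ d D i t : ℕ) : ℕ := if t ≤ ℓ then wU ℓ D (i + t) else 2 * D + i * (d - 1) + (t - ℓ - 1)

/-- edges of the connecting template -/
def cE (k ℓ D q : ℕ) : Finset ℕ :=
  if q < ℓ then pathEdge k ℓ (wA ℓ) q
  else if q < 2 * ℓ then pathEdge k ℓ (wB ℓ D) (q - ℓ)
  else (range k).image (wS ℓ (k - ℓ) D (q - 2 * ℓ))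

/-- top letters -/
def cTop (k ℓ D q : ℕ) : ℕ :=
  if q < ℓ then q * (k-ℓ) + k - 1 + ℓ
  else if q < 2 * ℓ then (q - ℓ) * (k - ℓ) + k - 1 + D
  else 2 * D + (q - 2 * ℓ) * (k - ℓ - 1) + (k - ℓ - 2)

lemma wU_inj {ℓ D : ℕ} (hD : 2 * ℓ ≤ D) {s t : ℕ} (hs : s < 2 * ℓ) (ht : t < 2 * ℓ)
    (h : wU ℓ D s = wU ℓ D t) : s = t := by
  unfold wU wA wB at h
  split_ifs at h <;> omega

lemma wU_bd {ℓ D : ℕ} (hD : 2 * ℓ ≤ D) {s : ℕ} (hs : s < 2 * ℓ) :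
    2 * ℓ ≤ wU ℓ D s ∧ wU ℓ D s < 2 * D := by
  unfold wU wA wB
  split_ifs <;> omega

lemma wS_inj {ℓ d D i : ℕ} (hD : 2 * ℓ ≤ D) (hi : i < ℓ) {s t : ℕ} 
    (h : wS ℓ d D i s = wS ℓ d D i t) : s = t := by
  unfold wS at h
  split_ifs at h with h1 h2 h2
  · have := wU_inj hD (by omega) (by omega) h; omega
  · have := (wU_bd hD (show i + s < 2 * ℓ by omega)).2; omega
  · have := (wU_bd hD (show i + t < 2 * ℓ by omega)).2; omega
  · omega

lemma wS_bd {ℓ d D i : ℕ} (hD : 2 * ℓ ≤ D) (hd : 2 ≤ d) (hi : i < ℓ) {t : ℕ} (ht : t < ℓ + d) :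
    2 * ℓ ≤ wS ℓ d D i t ∧ wS ℓ d D i t ≤ 2 * D + i * (d-1) + (d-2) := by
  unfold wS
  split_ifs
  · have := (wU_bd hD (show i + t < 2 * ℓ by omega)); omega
  · omega

lemma conn_tmpl {k ℓ : ℕ} (hl : 0 < ℓ) (hlk : ℓ + 2 ≤ k) :
    Tmpl k (2*ℓ) (2 * (ℓ + ℓ * (k-ℓ)) + ℓ * (k-ℓ-1)) (3*ℓ) (cE k ℓ (ℓ + ℓ * (k-ℓ)))
      (cTop k ℓ (ℓ + ℓ * (k-ℓ))) := by
  obtain ⟨d, rfl⟩ : ∃ d, k = ℓ + d := ⟨k - ℓ, by omega⟩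
  rw [Nat.add_sub_cancel_left]
  have hd : 2 ≤ d := by omega
  obtain ⟨D, hDD⟩ : ∃ D, D = ℓ + ℓ * d := ⟨_, rfl⟩
  rw [← hDD]
  have hld : ℓ * 2 ≤ ℓ * d := Nat.mul_le_mul_left _ hd
  have hD : 2 * ℓ ≤ D := by omega
  have hmul : ∀ s < ℓ, s * d + d ≤ ℓ * d := by
    intro s hs
    have := Nat.mul_le_mul_right d (Nat.succ_le_of_lt hs); rwa [Nat.succ_mul] at this
  have hmul' : ∀ s < ℓ, s * (d-1) + (d-1) ≤ ℓ * (d-1) := by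
    intro s hs
    have := Nat.mul_le_mul_right (d-1) (Nat.succ_le_of_lt hs); rwa [Nat.succ_mul] at this
  have hlt : ∀ s s', s < s' → s * d + d ≤ s' * d := by
    intro s s' hs
    have := Nat.mul_le_mul_right d (Nat.succ_le_of_lt hs); rwa [Nat.succ_mul] at this
  have hlt' : ∀ s s', s < s' → s * (d-1) + (d-1) ≤ s' * (d-1) := by
    intro s s' hs
    have := Nat.mul_le_mul_right (d-1) (Nat.succ_le_of_lt hs); rwa [Nat.succ_mul] at this
  have hAinj : ∀ s t, wA ℓ s = wA ℓ t → s = t := by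
    intro s t h; unfold wA at h; split_ifs at h <;> omega
  have hBinj : ∀ s t, wB ℓ D s = wB ℓ D t → s = t := by
    intro s t h; unfold wB at h; split_ifs at h <;> omega
  constructor
  · intro q hq
    unfold cE pathEdge
    split_ifs with h1 h2
    · rw [card_image_of_injective, card_range]
      intro s t h; have := hAinj _ _ h; omega
    · rw [card_image_of_injective, card_range]
      intro s t h; have := hBinj _ _ h; omega
    · rw [card_image_of_injective, card_range]
      intro s t h; exact wS_inj hD (by omega) h
  · intro q hq
    unfold cE cTop pathEdge
    rw [Nat.add_sub_cancel_left]
    split_ifs with h1 h2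
    · refine mem_image.2 ⟨ℓ + d - 1, by simp; omega, ?_⟩
      unfold wA; split_ifs <;> omega
    · refine mem_image.2 ⟨ℓ + d - 1, by simp; omega, ?_⟩
      unfold wB; split_ifs <;> omega
    · refine mem_image.2 ⟨ℓ + d - 1, by simp; omega, ?_⟩
      unfold wS; rw [if_neg (by omega)]; omega
  · intro q hq x hx
    unfold cE pathEdge at hx
    unfold cTop
    rw [Nat.add_sub_cancel_left] at hx ⊢
    split_ifs at hx ⊢ with h1 h2
    · obtain ⟨t, ht, rfl⟩ := mem_image.1 hx
      have ht := mem_range.1 ht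
      simp only [wA]; split_ifs <;> omega
    · obtain ⟨t, ht, rfl⟩ := mem_image.1 hx
      have ht := mem_range.1 ht
      simp only [wB]; split_ifs <;> omega
    · obtain ⟨t, ht, rfl⟩ := mem_image.1 hx
      have ht := mem_range.1 ht
      exact (wS_bd hD hd (by omega) ht).2
  · intro q hq
    unfold cTop
    rw [Nat.add_sub_cancel_left]
    split_ifs with h1 h2 <;> omega
  · intro q hq
    unfold cTop
    rw [Nat.add_sub_cancel_left]
    split_ifs with h1 h2
    · have := hmul q h1; omega
    · have := hmul (q-ℓ) (by omega); omega
    · have := hmul' (q-2*ℓ) (by omega); omega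
  · have hmono : ∀ q q', q < q' → q' < 3*ℓ → cTop (ℓ+d) ℓ D q < cTop (ℓ+d) ℓ D q' := by
      intro q q' hqq hq'
      unfold cTop
      rw [Nat.add_sub_cancel_left]
      split_ifs with h1 h2 h3 h4 h5 h6 h7 h8
      · have := hlt q q' hqq; omega
      · have := hmul q h1; omega
      · have := hmul q h1; omega
      · omega
      · have := hlt (q-ℓ) (q'-ℓ) (by omega); omega
      · have := hmul (q-ℓ) (by omega); omega
      · omega
      · omega
      · have := hlt' (q-2*ℓ) (q'-2*ℓ) (by omega); omega
    intro q hq q' hq' h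
    rcases lt_trichotomy q q' with h1 | h1 | h1
    · have := hmono q q' h1 hq'; omega
    · exact h1
    · have := hmono q' q h1 hq; omega

lemma conn_word {k ℓ : ℕ} (hl : 0 < ℓ) (hlk : ℓ + 2 ≤ k) (hnd : ¬ (k-ℓ) ∣ k) :
    ∃ N Q r E top, ∃ v : ℕ → ℕ, Tmpl k (2*ℓ) N Q E top ∧ 2 * ℓ ≤ N ∧
      IsWalk k ℓ r (fun e => ∃ q < Q, e = E q) v ∧ 2 * ℓ ≤ r ∧ (∀ t < ℓ, v t = t) ∧
      (∀ t < ℓ, v (r - ℓ + t) = 2*ℓ-1-t) ∧ (∀ t, ℓ ≤ t → t < r - ℓ → 2*ℓ ≤ v t) ∧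
      (∀ t < r, v t < N) := by
  obtain ⟨D, hDD⟩ : ∃ D, D = ℓ + ℓ * (k-ℓ) := ⟨_, rfl⟩
  have hld : ℓ * 2 ≤ ℓ * (k-ℓ) := Nat.mul_le_mul_left _ (by omega)
  have hD : 2 * ℓ ≤ D := by omega
  have hT := conn_tmpl hl hlk
  rw [← hDD] at hT
  have hmul : ∀ s, s * (k-ℓ) + k ≤ D → s < ℓ := by
    intro s hs
    by_contra hc
    have := Nat.mul_le_mul_right (k-ℓ) (not_lt.1 hc); omega
  have hkD : k ≤ D := by
    have : 1 * (k-ℓ) ≤ ℓ * (k-ℓ) := Nat.mul_le_mul_right _ hl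
    omega
  have hdiv : (k-ℓ) ∣ (D - k) := ⟨ℓ - 1, by
    rw [Nat.mul_sub, mul_comm, Nat.mul_one]; omega⟩
  set N := 2 * D + ℓ * (k-ℓ-1) with hN
  -- the middle part
  have mid : ∀ i, i ≤ ℓ → ∃ r v, IsWalk k ℓ r (fun e => ∃ q < 3*ℓ, e = cE k ℓ D q) v ∧
      (∀ t < ℓ, v t = t) ∧ (∀ t < ℓ, v (r - ℓ + t) = wU ℓ D (i + t)) ∧
      (∀ t, ℓ ≤ t → t < r → 2*ℓ ≤ v t) ∧ (∀ t < r, v t < N) := by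
    intro i
    induction i with
    | zero =>
      intro _
      refine ⟨D, wA ℓ, ⟨hkD, hdiv, ?_⟩, ?_, ?_, ?_, ?_⟩
      · intro s hs
        have hs := hmul s hs
        exact ⟨s, by omega, by unfold cE; rw [if_pos hs]⟩
      · intro t ht; simp [wA, ht]
      · intro t ht; simp [wU, ht]
      · intro t ht ht2; unfold wA; split_ifs <;> omega
      · intro t ht; unfold wA; split_ifs <;> omega
    | succ i ih =>
      intro hi
      obtain ⟨r, v, h1, h2, h3, h4, h5⟩ := ih (by omega)
      obtain ⟨r', v', g1, g2, g3, g4⟩ := rot_word hl (by omega) hnd (ℓ+1) (wS ℓ (k-ℓ) D i)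
      have hr := h1.1
      have hr' := g1.1
      have hvw : ∀ j < ℓ, v' j = v (r - ℓ + j) := by
        intro j hj
        rw [g2 j (by omega), h3 j hj, wS, if_pos (by omega)]
      have hv' : ∀ t, 2 * ℓ ≤ v' t ∧ v' t < N := by
        intro t
        obtain ⟨j, hj, hj2⟩ := g4 t
        have := wS_bd (d := k-ℓ) hD (by omega) (show i < ℓ by omega) (show j < ℓ + (k-ℓ) by omega)
        have h7 := Nat.mul_le_mul_right (k-ℓ-1) (show i+1 ≤ ℓ by omega)
        rw [Nat.succ_mul] at h7
        omega
      refine ⟨r + r' - ℓ, glue r ℓ v v', h1.glue (by omega) (g1.mono ?_) hvw, ?_, ?_, ?_, ?_⟩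
      · rintro e rfl
        refine ⟨2*ℓ+i, by omega, ?_⟩
        unfold cE
        rw [if_neg (by omega), if_neg (by omega), Nat.add_sub_cancel_left]
      · intro t ht; rw [glue_left (by omega), h2 t ht]
      · intro t ht
        rw [glue_last (by omega) (by omega) hvw, g3 t ht]
        rw [show k - ℓ + t + (ℓ+1) = (t+1) + k by omega, Nat.add_mod_right,
          Nat.mod_eq_of_lt (by omega), wS, if_pos (by omega)]
        congr 1; ring
      · intro t ht ht2
        rcases Nat.lt_or_ge t r with h | h
        · rw [glue_left h]; exact h4 t ht h
        · rw [glue_right (by omega) hvw (by omega)]; exact (hv' _).1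
      · intro t ht
        rcases Nat.lt_or_ge t r with h | h
        · rw [glue_left h]; exact h5 t h
        · rw [glue_right (by omega) hvw (by omega)]; exact (hv' _).2
  obtain ⟨r, v, h1, h2, h3, h4, h5⟩ := mid ℓ le_rfl
  have hr := h1.1
  have hB : IsWalk k ℓ D (fun e => ∃ q < 3*ℓ, e = cE k ℓ D q) (wB ℓ D) := by
    refine ⟨hkD, hdiv, ?_⟩
    intro s hs
    have hs := hmul s hs
    refine ⟨ℓ + s, by omega, ?_⟩
    unfold cE
    rw [if_neg (by omega), if_pos (by omega), Nat.add_sub_cancel_left]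
  have hvw : ∀ j < ℓ, wB ℓ D (D - 1 - j) = v (r - ℓ + j) := by
    intro j hj
    rw [h3 j hj, wU, if_neg (by omega), Nat.add_sub_cancel_left]
  refine ⟨N, 3*ℓ, r + D - ℓ, cE k ℓ D, cTop k ℓ D, glue r ℓ v (fun i => wB ℓ D (D-1-i)), hT,
    by omega, h1.glue (by omega) hB.reverse hvw, by omega, ?_, ?_, ?_, ?_⟩
  · intro t ht; rw [glue_left (by omega), h2 t ht]
  · intro t ht
    rw [glue_last (by omega) (by omega) hvw]
    simp only [wB]; split_ifs <;> omega
  · intro t ht ht2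
    rcases Nat.lt_or_ge t r with h | h
    · rw [glue_left h]; exact h4 t ht h
    · rw [glue_right (by omega) hvw (by omega)]
      simp only [wB]; split_ifs <;> omega
  · intro t ht
    rcases Nat.lt_or_ge t r with h | h
    · rw [glue_left h]; exact h5 t h
    · rw [glue_right (by omega) hvw (by omega)]
      simp only [wB]; split_ifs <;> omega

end AbsPath

open Finset
namespace AbsPath

lemma blow1 {X V : Type} [Finite X] [Finite V] {t : ℕ} (ht : 1 ≤ t) (R : X → V → Prop) {c : ℝ}
    (hc : 0 ≤ c)
    (h : c * Nat.card X * Nat.card V ≤ Nat.card {p : X × V // R p.1 p.2}) :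
    c ^ t * Nat.card X * (Nat.card V : ℝ) ^ t ≤
      Nat.card {p : X × (Fin t → V) // ∀ j, R p.1 (p.2 j)} := by
  classical
  have := Fintype.ofFinite X
  have := Fintype.ofFinite V
  have h1 : Nat.card {p : X × V // R p.1 p.2} = ∑ x, Nat.card {v // R x v} := by
    rw [Nat.card_congr (Equiv.subtypeProdEquivSigmaSubtype R), Nat.card_sigma]
  have h2 : Nat.card {p : X × (Fin t → V) // ∀ j, R p.1 (p.2 j)} =
      ∑ x, Nat.card {v // R x v} ^ t := by
    rw [Nat.card_congr (Equiv.subtypeProdEquivSigmaSubtype (fun x (f : Fin t → V) => ∀ j, R x (f j))),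
      Nat.card_sigma]
    apply Finset.sum_congr rfl
    intro x _
    rw [Nat.card_congr (Equiv.subtypePiEquivPi (p := fun _ v => R x v)), Nat.card_fun]
    simp
  rw [h1] at h
  rw [h2]
  push_cast at h ⊢
  obtain ⟨s, rfl⟩ : ∃ s, t = s + 1 := ⟨t - 1, by omega⟩
  have h3 := pow_sum_div_card_le_sum_pow (s := (univ : Finset X))
    (f := fun x => (Nat.card {v // R x v} : ℝ)) (fun i _ => by positivity) s
  refine le_trans ?_ h3
  rcases isEmpty_or_nonempty X with hX | hX
  · simp
  have hXp : (0 : ℝ) < (Fintype.card X : ℝ) := by exact_mod_cast Fintype.card_pos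
  rw [Nat.card_eq_fintype_card (α := X)] at h ⊢
  rw [le_div_iff₀ (by rw [card_univ]; positivity), card_univ]
  calc c ^ (s+1) * (Fintype.card X : ℝ) * (Nat.card V : ℝ)^(s+1) * (Fintype.card X : ℝ)^s
      = (c * Fintype.card X * Nat.card V)^(s+1) := by ring
    _ ≤ _ := pow_le_pow_left₀ (by positivity) h _

lemma blowN {V : Type} [Finite V] {t : ℕ} (ht : 1 ≤ t) (N : ℕ) : ∀ {X : Type} [Finite X]
    (R : X → (Fin N → V) → Prop) {c : ℝ} (_ : 0 ≤ c)
    (_ : c * Nat.card X * (Nat.card V : ℝ) ^ N ≤ Nat.card {p : X × (Fin N → V) // R p.1 p.2}),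
    c ^ (t ^ N) * Nat.card X * ((Nat.card V : ℝ) ^ t) ^ N ≤
      Nat.card {p : X × (Fin N → Fin t → V) // ∀ j : Fin N → Fin t, R p.1 (fun i => p.2 i (j i))} := by
  induction N with
  | zero =>
    intro X _ R c hc h
    simp only [pow_zero, pow_one, mul_one] at h ⊢
    refine h.trans (le_of_eq ?_)
    congr 1
    apply Nat.card_congr
    refine ⟨fun p => ⟨(p.1.1, Fin.elim0), fun j => by
      rw [Subsingleton.elim (fun i => _) p.1.2]; exact p.2⟩,
      fun p => ⟨(p.1.1, Fin.elim0), by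
        have := p.2 Fin.elim0
        rw [Subsingleton.elim (fun i => _) (Fin.elim0 : Fin 0 → V)] at this; exact this⟩, ?_, ?_⟩
    · intro p; apply Subtype.ext; apply Prod.ext; rfl; exact Subsingleton.elim _ _
    · intro p; apply Subtype.ext; apply Prod.ext; rfl; exact Subsingleton.elim _ _
  | succ N ih =>
    intro X _ R c hc h
    have h1 := ih (X := X × V) (fun x y => R x.1 (Fin.cons x.2 y)) hc (by
      rw [Nat.card_prod]; push_cast
      have e : Nat.card {p : X × (Fin (N+1) → V) // R p.1 p.2} =
          Nat.card {p : (X × V) × (Fin N → V) // R p.1.1 (Fin.cons p.1.2 p.2)} := by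
        apply Nat.card_congr
        refine ⟨fun p => ⟨((p.1.1, p.1.2 0), Fin.tail p.1.2), ?_⟩,
          fun p => ⟨(p.1.1.1, Fin.cons p.1.1.2 p.1.2), p.2⟩, ?_, ?_⟩
        · have := p.2; rw [← Fin.cons_self_tail p.1.2] at this; exact this
        · intro p; apply Subtype.ext; apply Prod.ext; rfl; exact Fin.cons_self_tail _
        · intro p; apply Subtype.ext; simp
      rw [← e]
      refine le_trans (le_of_eq ?_) h
      ring)
    have h2 := blow1 (X := X × (Fin N → Fin t → V)) (V := V) ht
      (fun x v => ∀ j : Fin N → Fin t, R x.1 (Fin.cons v (fun i => x.2 i (j i))))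
      (c := c ^ (t ^ N)) (by positivity) (by
        have e : Nat.card {p : (X × V) × (Fin N → Fin t → V) // ∀ j : Fin N → Fin t,
              R p.1.1 (Fin.cons p.1.2 (fun i => p.2 i (j i)))} =
            Nat.card {p : (X × (Fin N → Fin t → V)) × V // ∀ j : Fin N → Fin t,
              R p.1.1 (Fin.cons p.2 (fun i => p.1.2 i (j i)))} := by
          apply Nat.card_congr
          exact ⟨fun p => ⟨((p.1.1.1, p.1.2), p.1.1.2), p.2⟩, fun p => ⟨((p.1.1.1, p.1.2), p.1.1.2), p.2⟩,
            fun p => rfl, fun p => rfl⟩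
        rw [← e]
        refine le_trans (le_of_eq ?_) h1
        simp only [Nat.card_prod, Nat.card_fun, Nat.card_fin]
        push_cast; ring)
    have e : Nat.card {p : (X × (Fin N → Fin t → V)) × (Fin t → V) // ∀ a, ∀ j : Fin N → Fin t,
              R p.1.1 (Fin.cons (p.2 a) (fun i => p.1.2 i (j i)))} =
          Nat.card {p : X × (Fin (N+1) → Fin t → V) // ∀ j : Fin (N+1) → Fin t, R p.1 (fun i => p.2 i (j i))} := by
      apply Nat.card_congr
      refine ⟨fun p => ⟨(p.1.1.1, Fin.cons p.1.2 p.1.1.2), ?_⟩,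
        fun p => ⟨((p.1.1, Fin.tail p.1.2), p.1.2 0), ?_⟩, ?_, ?_⟩
      · intro j
        have := p.2 (j 0) (Fin.tail j)
        convert this using 1
        funext i
        refine Fin.cases ?_ (fun i => ?_) i <;> simp [Fin.tail]
      · intro a j
        have := p.2 (Fin.cons a j)
        convert this using 1
        funext i
        refine Fin.cases ?_ (fun i => ?_) i <;> simp [Fin.tail]
      · intro p; apply Subtype.ext; simp
      · intro p; apply Subtype.ext; simp
    rw [← e]
    refine le_trans (le_of_eq ?_) h2
    simp only [Nat.card_prod, Nat.card_fun, Nat.card_fin]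
    push_cast; ring

lemma blow {V : Type} [Finite V] {t : ℕ} (ht : 1 ≤ t) (N : ℕ) 
    (R : (Fin N → V) → Prop) {c : ℝ} (hc : 0 ≤ c)
    (h : c * (Nat.card V : ℝ) ^ N ≤ Nat.card {y : Fin N → V // R y}) :
    c ^ (t ^ N) * (Nat.card V : ℝ) ^ (t * N) ≤
      Nat.card {f : Fin N × Fin t → V // ∀ j : Fin N → Fin t, R (fun i => f (i, j i))} := by
  have e1 : Nat.card {p : Unit × (Fin N → V) // R p.2} = Nat.card {y : Fin N → V // R y} :=
    Nat.card_congr ⟨fun y => ⟨y.1.2, y.2⟩, fun y => ⟨((), y.1), y.2⟩, fun _ => rfl, fun _ => rfl⟩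
  have e2 : Nat.card {p : Unit × (Fin N → Fin t → V) // ∀ j : Fin N → Fin t, R (fun i => p.2 i (j i))} =
      Nat.card {f : Fin N × Fin t → V // ∀ j : Fin N → Fin t, R (fun i => f (i, j i))} :=
    Nat.card_congr ⟨fun y => ⟨fun i => y.1.2 i.1 i.2, y.2⟩, fun y => ⟨((), fun i j => y.1 (i,j)), y.2⟩,
      fun _ => rfl, fun _ => rfl⟩
  have h1 := blowN (V := V) ht N (X := Unit) (fun _ => R) hc (by
    rw [e1]; simpa using h)
  rw [e2] at h1
  simpa [pow_mul] using h1

lemma seq_count {V : Type} [Finite V] (P : (j : ℕ) → (Fin j → V) → Prop) {C : ℝ} (hC : 0 ≤ C)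
    (j0 m : ℕ) 
    (h : ∀ j, j0 ≤ j → j < j0 + m → ∀ y, P j y → C ≤ Nat.card {v // P (j+1) (Fin.snoc y v)}) :
    C ^ m * Nat.card {y : Fin j0 → V // P j0 y} ≤ Nat.card {y : Fin (j0 + m) → V // P (j0+m) y} := by
  classical
  have := Fintype.ofFinite V
  induction m with
  | zero => simp
  | succ m ih =>
    have h1 := ih (fun j hj hj' => h j hj (by omega))
    have h2 : C * (Nat.card {y : Fin (j0 + m) → V // P (j0+m) y} : ℝ) ≤
      Nat.card (Σ y : {y : Fin (j0 + m) → V // P (j0+m) y}, {v // P (j0+m+1) (Fin.snoc y.1 v)}) := by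
      rw [Nat.card_sigma]; push_cast
      rw [Nat.card_eq_fintype_card, mul_comm, ← nsmul_eq_mul]
      apply Finset.card_nsmul_le_sum
      intro y _
      exact h _ (by omega) (by omega) _ y.2
    have h3 : Nat.card (Σ y : {y : Fin (j0 + m) → V // P (j0+m) y}, {v // P (j0+m+1) (Fin.snoc y.1 v)})
        ≤ Nat.card {y : Fin (j0 + m + 1) → V // P (j0+m+1) y} := by
      apply Nat.card_le_card_of_injective (fun p => ⟨Fin.snoc p.1.1 p.2.1, p.2.2⟩)
      rintro ⟨⟨y, hy⟩, ⟨v, hv⟩⟩ ⟨⟨y', hy'⟩, ⟨v', hv'⟩⟩ he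
      simp only [Subtype.mk.injEq] at he
      obtain ⟨rfl, rfl⟩ := Fin.snoc_injective2 he
      rfl
    calc C ^ (m+1) * (Nat.card {y : Fin j0 → V // P j0 y} : ℝ) 
        = C * (C^m * Nat.card {y : Fin j0 → V // P j0 y}) := by ring
      _ ≤ C * Nat.card {y : Fin (j0 + m) → V // P (j0+m) y} := by gcongr
      _ ≤ _ := h2.trans (by exact_mod_cast h3)

lemma good_maps {ι V : Type} [Fintype ι] [DecidableEq ι] [Fintype V] (W : Finset V)
    (Q : (ι → V) → Prop) {A : ℝ} (h : A ≤ Nat.card {g : ι → V // Q g}) :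
    A - ((Fintype.card ι : ℝ)^2 + Fintype.card ι * W.card) * (Fintype.card V : ℝ)^(Fintype.card ι - 1) ≤
      Nat.card {g : ι → V // Q g ∧ Function.Injective g ∧ ∀ i, g i ∉ W} := by
  classical
  have hc : ∀ i : ι, Fintype.card {x // x ≠ i} = Fintype.card ι - 1 := by
    intro i; simp [Fintype.card_subtype_compl]
  have h1 : ∀ i : ι × ι, (univ.filter (fun g : ι → V => i.1 ≠ i.2 ∧ g i.1 = g i.2)).card ≤
      Fintype.card V ^ (Fintype.card ι - 1) := by
    intro i
    rw [← hc i.1, ← Fintype.card_fun, ← card_univ (α := {x // x ≠ i.1} → V)]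
    apply Finset.card_le_card_of_injOn (fun g x => g x.1) (fun _ _ => mem_coe.2 (mem_univ _))
    intro g hg g' hg' he
    simp only [coe_filter, mem_univ, true_and, Set.mem_setOf_eq] at hg hg'
    funext x
    by_cases hx : x = i.1
    · rw [hx, hg.2, hg'.2]; exact congrFun he ⟨i.2, hg.1.symm⟩
    · exact congrFun he ⟨x, hx⟩
  have h2 : ∀ i : ι, (univ.filter (fun g : ι → V => g i ∈ W)).card ≤
      W.card * Fintype.card V ^ (Fintype.card ι - 1) := by
    intro i
    rw [← hc i, ← Fintype.card_fun, ← card_univ (α := {x // x ≠ i} → V), ← card_product]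
    apply Finset.card_le_card_of_injOn (fun g => (g i, fun x => g x.1))
    · intro g hg
      simpa using hg
    intro g hg g' hg' he
    simp only [Prod.mk.injEq] at he
    funext x
    by_cases hx : x = i
    · rw [hx, he.1]
    · exact congrFun he.2 ⟨x, hx⟩
  have h3 : (univ.filter (fun g : ι → V => Q g)) ⊆
      (univ.filter (fun g : ι → V => Q g ∧ Function.Injective g ∧ ∀ i, g i ∉ W)) ∪
      ((univ : Finset (ι × ι)).biUnion (fun i => (univ.filter (fun g : ι → V => i.1 ≠ i.2 ∧ g i.1 = g i.2))) ∪
      (univ : Finset ι).biUnion (fun i => (univ.filter (fun g : ι → V => g i ∈ W)))) := by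
    intro g hg
    simp only [mem_filter, mem_univ, true_and, mem_union, mem_biUnion] at hg ⊢
    by_contra hcon
    push Not at hcon
    obtain ⟨ha, hb, hd⟩ := hcon
    obtain ⟨i, hi⟩ := ha hg (fun x y hxy => by
      by_contra hne; exact hb (x, y) hne hxy)
    exact hd i hi
  have h4 := (card_le_card h3).trans ((card_union_le _ _).trans
    (Nat.add_le_add_left ((card_union_le _ _).trans (Nat.add_le_add
      (card_biUnion_le_card_mul _ _ _ (fun i _ => h1 i))
      (card_biUnion_le_card_mul _ _ _ (fun i _ => h2 i)))) _))
  rw [Nat.card_eq_fintype_card, Fintype.card_subtype] at h ⊢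
  have h5 := Nat.cast_le (α := ℝ) |>.2 h4
  simp only [card_univ, Fintype.card_prod] at h5
  push_cast at h5
  nlinarith [h5, h]

lemma codeg {n k : ℕ} {H : Finset (Finset (Fin n))} (hk : 0 < k) (hH : IsKGraph n k H) {x : ℝ}
    (hd : MinDegreeGe n k H x) {A : Finset (Fin n)} (hA : A.card = k - 1) :
    x ≤ ((univ.filter (fun v => v ∉ A ∧ insert v A ∈ H)).card : ℝ) := by
  refine (hd A hA).trans ?_
  unfold degree
  norm_cast
  have : H.filter (fun e => A ⊆ e) ⊆
      (univ.filter (fun v => v ∉ A ∧ insert v A ∈ H)).image (fun v => insert v A) := by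
    intro e he
    simp only [mem_filter] at he
    obtain ⟨he, hAe⟩ := he
    have hc := hH e he
    have : (e \ A).card = 1 := by rw [card_sdiff_of_subset hAe]; omega
    obtain ⟨v, hv⟩ := card_eq_one.1 this
    have hv' : v ∈ e \ A := by rw [hv]; simp
    have hi : insert v A = e := by
      rw [insert_eq, ← hv, sdiff_union_of_subset hAe]
    simp only [mem_image, mem_filter, mem_univ, true_and]
    exact ⟨v, ⟨(mem_sdiff.1 hv').2, by rw [hi]; exact he⟩, hi⟩
  exact (card_le_card this).trans card_image_le

end AbsPath

open Finset
namespace AbsPath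

/-- extension of a root assignment by a tuple -/
def ext {n : ℕ} (ρ : ℕ) (root : ℕ → Fin n) {j : ℕ} (y : Fin j → Fin n) (a : ℕ) : Fin n :=
  if a < ρ then root a else if h : a - ρ < j then y ⟨a - ρ, h⟩ else root 0

/-- partial embeddings of a template -/
def TP {n : ℕ} (ρ Q : ℕ) (E : ℕ → Finset ℕ) (top : ℕ → ℕ) (H : Finset (Finset (Fin n)))
    (root : ℕ → Fin n) (j : ℕ) (y : Fin j → Fin n) : Prop :=
  Set.InjOn (ext ρ root y) (Set.Iio (ρ + j)) ∧
    ∀ q < Q, top q < ρ + j → (E q).image (ext ρ root y) ∈ H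

lemma ext_snoc_lt {n ρ j : ℕ} {root : ℕ → Fin n} {y : Fin j → Fin n} {v : Fin n} {a : ℕ}
    (ha : a < ρ + j) : ext ρ root (Fin.snoc y v : Fin (j+1) → Fin n) a = ext ρ root y a := by
  unfold ext
  split_ifs with h1 h2 h3 h4
  · rfl
  · have : (⟨a - ρ, h2⟩ : Fin (j+1)) = Fin.castSucc ⟨a - ρ, h3⟩ := rfl
    rw [this, Fin.snoc_castSucc]
  · omega
  · omega
  · omega

lemma ext_snoc_eq {n ρ j : ℕ} {root : ℕ → Fin n} {y : Fin j → Fin n} {v : Fin n} :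
    ext ρ root (Fin.snoc y v : Fin (j+1) → Fin n) (ρ + j) = v := by
  unfold ext
  rw [if_neg (by omega), dif_pos (by omega)]
  have : (⟨ρ + j - ρ, by omega⟩ : Fin (j+1)) = Fin.last j := by ext; simp
  rw [this, Fin.snoc_last]

lemma tp_step {n k ρ N Q : ℕ} {E : ℕ → Finset ℕ} {top : ℕ → ℕ} (hT : Tmpl k ρ N Q E top)
    {H : Finset (Finset (Fin n))} {root : ℕ → Fin n} (hk : 0 < k) (hH : IsKGraph n k H) {x C : ℝ}
    (hd : MinDegreeGe n k H x) (hC1 : C + N ≤ x) (hC2 : C + N ≤ n)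
    {j : ℕ} (hj : ρ + j < N) (y : Fin j → Fin n) (hy : TP ρ Q E top H root j y) :
    C ≤ Nat.card {v // TP ρ Q E top H root (j+1) (Fin.snoc y v)} := by
  classical
  set U := (range (ρ + j)).image (ext ρ root y) with hU
  have hUc : U.card ≤ N := card_image_le.trans (by simp; omega)
  have key : ∃ Z : Finset (Fin n), C + N ≤ Z.card ∧ ∀ v ∈ Z, ∀ q < Q, top q = ρ + j →
      insert v (((E q).erase (top q)).image (ext ρ root y)) ∈ H := by
    by_cases hq : ∃ q < Q, top q = ρ + j
    · obtain ⟨q, hq, hqt⟩ := hq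
      have hA : (((E q).erase (top q)).image (ext ρ root y)).card = k - 1 := by
        rw [card_image_of_injOn, card_erase_of_mem (hT.mem q hq), hT.card q hq]
        intro a ha b hb hab
        simp only [coe_erase, Set.mem_sdiff, mem_coe, Set.mem_singleton_iff] at ha hb
        have h1 := hT.sub q hq a ha.1
        have h2 := hT.sub q hq b hb.1
        exact hy.1 (by simp only [Set.mem_Iio]; omega) (by simp only [Set.mem_Iio]; omega) hab
      refine ⟨_, hC1.trans (codeg hk hH hd hA), ?_⟩
      intro v hv q' hq' hqt'
      obtain rfl := hT.inj q hq q' hq' (by omega)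
      exact (mem_filter.1 hv).2.2
    · push Not at hq
      refine ⟨univ, by simpa using hC2, ?_⟩
      intro v _ q hq' hqt
      exact absurd hqt (hq q hq')
  obtain ⟨Z, hZ, hZH⟩ := key
  have h1 : (Z.card : ℝ) ≤ ((Z \ U).card : ℝ) + U.card := by
    exact_mod_cast (card_le_card_sdiff_add_card)
  have h2 : ((Z \ U).card : ℝ) ≤ Nat.card {v // TP ρ Q E top H root (j+1) (Fin.snoc y v)} := by
    rw [Nat.card_eq_fintype_card, Fintype.card_subtype]
    norm_cast
    apply card_le_card
    intro v hv
    rw [mem_sdiff] at hv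
    simp only [mem_filter, mem_univ, true_and]
    have hvU : ∀ a < ρ + j, ext ρ root y a ≠ v := by
      intro a ha he
      exact hv.2 (mem_image.2 ⟨a, mem_range.2 ha, he⟩)
    constructor
    · intro a ha b hb hab
      simp only [Set.mem_Iio] at ha hb
      rcases Nat.lt_or_ge a (ρ + j) with h1 | h1 <;> rcases Nat.lt_or_ge b (ρ + j) with h2 | h2
      · rw [ext_snoc_lt h1, ext_snoc_lt h2] at hab
        exact hy.1 h1 h2 hab
      · obtain rfl : b = ρ + j := by omega
        rw [ext_snoc_lt h1, ext_snoc_eq] at hab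
        exact absurd hab (hvU a h1)
      · obtain rfl : a = ρ + j := by omega
        rw [ext_snoc_lt h2, ext_snoc_eq] at hab
        exact absurd hab.symm (hvU b h2)
      · omega
    · intro q hq hqt
      rcases Nat.lt_or_ge (top q) (ρ + j) with h1 | h1
      · rw [show (E q).image (ext ρ root (Fin.snoc y v : Fin (j+1) → Fin n)) = (E q).image (ext ρ root y) from ?_]
        · exact hy.2 q hq h1
        · apply image_congr
          intro a ha
          exact ext_snoc_lt (lt_of_le_of_lt (hT.sub q hq a ha) h1)
      · have hqe : top q = ρ + j := by omega
        have := hZH v hv.1 q hq hqe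
        rw [← insert_erase (hT.mem q hq), image_insert]
        convert this using 2
        · rw [hqe]; exact ext_snoc_eq
        · apply image_congr
          intro a ha
          simp only [coe_erase, Set.mem_sdiff, mem_coe, Set.mem_singleton_iff] at ha
          have h1 := hT.sub q hq a ha.1
          exact ext_snoc_lt (by omega)
  have h3 : (U.card : ℝ) ≤ N := by exact_mod_cast hUc
  linarith

lemma tp_count {n k ρ M Q : ℕ} {E : ℕ → Finset ℕ} {top : ℕ → ℕ} (hT : Tmpl k ρ (ρ + M) Q E top)
    {H : Finset (Finset (Fin n))} {root : ℕ → Fin n} (hk : 0 < k) (hH : IsKGraph n k H) {x C : ℝ}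
    (hd : MinDegreeGe n k H x) (hC0 : 0 ≤ C) (hC1 : C + (ρ + M) ≤ x) (hC2 : C + (ρ + M) ≤ n)
    (hroot : Set.InjOn root (Set.Iio ρ)) :
    C ^ M ≤ Nat.card {y : Fin M → Fin n // TP ρ Q E top H root M y} := by
  have h := seq_count (V := Fin n) (fun j y => TP ρ Q E top H root j y) hC0 0 M
    (fun j _ hj y hy => tp_step hT hk hH hd (by push_cast; exact hC1) (by push_cast; exact hC2)
      (by omega) y hy)
  have h0 : 0 < Nat.card {y : Fin 0 → Fin n // TP ρ Q E top H root 0 y} := by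
    rw [Nat.card_pos_iff]
    refine ⟨⟨⟨Fin.elim0, ?_, ?_⟩⟩, inferInstance⟩
    · intro a ha b hb hab
      simp only [Set.mem_Iio, Nat.add_zero] at ha hb
      simp only [ext, ha, hb, if_true] at hab
      exact hroot ha hb hab
    · intro q hq hqt
      have := hT.ge q hq
      omega
  rw [Nat.zero_add] at h
  refine le_trans ?_ h
  have : (1 : ℝ) ≤ Nat.card {y : Fin 0 → Fin n // TP ρ Q E top H root 0 y} := by exact_mod_cast h0
  have h5 : 0 ≤ C ^ M := by positivity
  nlinarith

lemma exists_big (a b : ℝ) (ha : 0 < a) : ∃ n1 : ℕ, ∀ n : ℕ, n1 ≤ n → b ≤ a * n := by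
  obtain ⟨n1, h⟩ := exists_nat_ge (b / a)
  refine ⟨n1, fun n hn => ?_⟩
  rw [div_le_iff₀ ha] at h
  have : (n1 : ℝ) ≤ n := by exact_mod_cast hn
  nlinarith

lemma connect {k ℓ : ℕ} (hl : 0 < ℓ) (hlk : ℓ + 2 ≤ k) (hnd : ¬ (k - ℓ) ∣ k) :
    ∃ L, k ≤ L ∧ 2 * ℓ ≤ L ∧ ∀ μ : ℝ, 0 < μ → ∃ ε : ℝ, 0 < ε ∧ ∃ n1 : ℕ, ∀ n ≥ n1,
      ∀ H : Finset (Finset (Fin n)), IsKGraph n k H → MinDegreeGe n k H (μ * n) →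
      ∀ A B : ℕ → Fin n, Set.InjOn A (Set.Iio ℓ) → Set.InjOn B (Set.Iio ℓ) →
        (∀ i < ℓ, ∀ j < ℓ, A i ≠ B j) → ∀ W : Finset (Fin n), (W.card : ℝ) ≤ ε * n →
        ∃ v : ℕ → Fin n, IsPathSeq k ℓ L (· ∈ H) v ∧ (∀ i < ℓ, v i = A i) ∧
          (∀ i < ℓ, v (L - ℓ + i) = B i) ∧ ∀ i, ℓ ≤ i → i < L - ℓ → v i ∉ W := by
  classical
  obtain ⟨N, Q, r, E, top, lam, hT, hN, hw, hr, hw1, hw2, hw3, hw4⟩ := conn_word hl hlk hnd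
  obtain ⟨M, rfl⟩ : ∃ M, N = 2 * ℓ + M := ⟨N - 2 * ℓ, by omega⟩
  refine ⟨r, hw.1, hr, ?_⟩
  intro μ hμ
  set κ : ℝ := min μ 1 / 2 with hκ
  have hκ0 : 0 < κ := by positivity
  set m := M * r with hm
  set c : ℝ := (κ ^ M) ^ (r ^ M) with hc
  have hc0 : 0 < c := by positivity
  obtain ⟨n1, hn1⟩ := exists_big κ (2 * ℓ + M) hκ0
  obtain ⟨n2, hn2⟩ := exists_big (c/2) (m^2 + m * (2 * ℓ) + 1) (by positivity)
  refine ⟨c / (2 * (m+1)), by positivity, max n1 n2, ?_⟩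
  intro n hn H hH hd A B hA hB hAB W hW
  have hn1 := hn1 n (le_trans (le_max_left _ _) hn)
  have hn2 := hn2 n (le_trans (le_max_right _ _) hn)
  set root : ℕ → Fin n := fun a => if a < ℓ then A a else B (2*ℓ-1-a) with hroot
  have hri : Set.InjOn root (Set.Iio (2*ℓ)) := by
    intro a ha b hb hab
    simp only [Set.mem_Iio] at ha hb
    simp only [hroot] at hab
    split_ifs at hab with h1 h2 h2
    · exact hA h1 h2 hab
    · exact absurd hab (hAB _ h1 _ (by omega))
    · exact absurd hab.symm (hAB _ h2 _ (by omega))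
    · have := hB (show 2*ℓ-1-a < ℓ by omega) (show 2*ℓ-1-b < ℓ by omega) hab
      omega
  have hκμ : 2 * κ ≤ μ := by rw [hκ]; linarith [min_le_left μ 1]
  have hκ1 : 2 * κ ≤ 1 := by rw [hκ]; linarith [min_le_right μ 1]
  have hn0 : (0:ℝ) ≤ n := by positivity
  have hcount := tp_count (C := κ * n) hT (by omega) hH hd (by positivity)
    (by push_cast; nlinarith) (by push_cast; nlinarith) hri
  have hb := blow (V := Fin n) (t := r) (by omega) M (TP (2*ℓ) Q E top H root M) (c := κ ^ M)
    (by positivity) (by rw [Nat.card_fin, ← mul_pow]; exact hcount)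
  rw [← hc] at hb
  set W' := W ∪ (range (2*ℓ)).image root with hW'
  have hWc : (W'.card : ℝ) ≤ c / (2 * (m+1)) * n + 2 * ℓ := by
    have h1 : W'.card ≤ W.card + 2 * ℓ := (card_union_le _ _).trans
      (Nat.add_le_add_left (card_image_le.trans (by simp)) _)
    have h2 : (W'.card : ℝ) ≤ W.card + 2 * ℓ := by exact_mod_cast h1
    linarith
  have hg := good_maps W' _ hb
  have hpos : 0 < Nat.card {g : Fin M × Fin r → Fin n // (∀ j : Fin M → Fin r, 
      TP (2*ℓ) Q E top H root M (fun i => g (i, j i))) ∧ Function.Injective g ∧ ∀ i, g i ∉ W'} := by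
    have : (0 : ℝ) < Nat.card {g : Fin M × Fin r → Fin n // (∀ j : Fin M → Fin r, 
      TP (2*ℓ) Q E top H root M (fun i => g (i, j i))) ∧ Function.Injective g ∧ ∀ i, g i ∉ W'} := by
      refine lt_of_lt_of_le ?_ hg
      simp only [Fintype.card_prod, Fintype.card_fin, Nat.card_fin]
      rw [mul_comm r M, ← hm]
      rcases Nat.eq_zero_or_pos m with h0 | h0
      · rw [h0]
        have : ((M : ℕ) * r : ℕ) = 0 := h0
        simp [this, hc0]
      · have hm1 : (1:ℝ) ≤ m := by exact_mod_cast h0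
        have hnp : (0:ℝ) < n := by
          rcases hn0.eq_or_lt with h | h
          · rw [← h] at hn2; nlinarith [sq_nonneg (m:ℝ), mul_nonneg (Nat.cast_nonneg (α := ℝ) m) (Nat.cast_nonneg (α := ℝ) ℓ)]
          · exact h
        have h3 : (m:ℝ) * (c / (2 * (m+1)) * n) ≤ c / 2 * n := by
          have h5 : (m:ℝ) * (c / (2 * (m+1)) * n) = (m / (m+1)) * (c/2*n) := by field_simp
          rw [h5]
          have : (m:ℝ) / (m+1) ≤ 1 := by rw [div_le_one (by positivity)]; linarith
          have h6 : 0 ≤ c/2*n := by positivity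
          nlinarith
        have h4 : (m:ℝ)^2 + m * W'.card < c * n := by nlinarith
        obtain ⟨m', hm'⟩ : ∃ m', m = m' + 1 := ⟨m - 1, by omega⟩
        have h6 : c * (n:ℝ)^m = (c * n) * (n:ℝ)^(m-1) := by
          rw [hm']; simp only [Nat.add_sub_cancel]; ring
        have h7 : (0:ℝ) < (n:ℝ)^(m-1) := by positivity
        push_cast
        rw [h6]
        nlinarith
    exact_mod_cast this
  obtain ⟨⟨f, hf1, hf2, hf3⟩⟩ := (Nat.card_pos_iff.1 hpos).1
  have hr0 : 0 < r := by omega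
  -- the path
  set w : ℕ → Fin n := fun p => if lam p < 2*ℓ then root (lam p) else
    if h : lam p - 2*ℓ < M then f (⟨lam p - 2*ℓ, h⟩, ⟨p % r, Nat.mod_lt _ hr0⟩) else root 0 with hwdef
  have wroot : ∀ p, lam p < 2*ℓ → w p = root (lam p) := by
    intro p hp; simp only [hwdef, hp, if_true]
  have wint : ∀ p, p < r → (h : 2*ℓ ≤ lam p) → ∃ h', w p = f (⟨lam p - 2*ℓ, h'⟩, ⟨p % r, Nat.mod_lt _ hr0⟩) := by
    intro p hp h
    have := hw4 p hp
    refine ⟨by omega, ?_⟩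
    simp only [hwdef]
    rw [if_neg (by omega), dif_pos (by omega)]
  have wI : ∀ p, ℓ ≤ p → p < r - ℓ → w p ∉ W' := by
    intro p h1 h2
    obtain ⟨h', he⟩ := wint p (by omega) (hw3 p h1 h2)
    rw [he]; exact hf3 _
  have wA : ∀ p < ℓ, w p = A p := by
    intro p hp
    rw [wroot p (by rw [hw1 p hp]; omega), hw1 p hp]
    simp only [hroot, hp, if_true]
  have wB : ∀ p < ℓ, w (r - ℓ + p) = B p := by
    intro p hp
    rw [wroot _ (by rw [hw2 p hp]; omega), hw2 p hp]
    simp only [hroot]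
    rw [if_neg (by omega)]
    congr 1; omega
  have AW : ∀ p < ℓ, A p ∈ W' := by
    intro p hp
    refine mem_union_right _ (mem_image.2 ⟨p, mem_range.2 (by omega), ?_⟩)
    simp only [hroot, hp, if_true]
  have BW : ∀ p < ℓ, B p ∈ W' := by
    intro p hp
    refine mem_union_right _ (mem_image.2 ⟨2*ℓ-1-p, mem_range.2 (by omega), ?_⟩)
    simp only [hroot]
    rw [if_neg (by omega)]
    congr 1; omega
  refine ⟨w, isPathSeq_iff.2 ⟨⟨hw.1, hw.2.1, ?_⟩, ?_⟩, wA, wB, fun i h1 h2 h => wI i h1 h2 (mem_union_left _ h)⟩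
  · intro s hs
    obtain ⟨q, hq, hE⟩ := hw.2.2 s hs
    have hinj : Set.InjOn (fun t => lam (s * (k-ℓ) + t)) (range k : Finset ℕ) := by
      rw [← card_image_iff]
      rw [card_range]
      have := hT.card q hq
      rw [← hE] at this
      exact this
    -- selector
    set j : Fin M → Fin r := fun a => 
      if h : ∃ t, t < k ∧ lam (s * (k-ℓ) + t) = a + 2*ℓ then
        ⟨(s * (k-ℓ) + h.choose) % r, Nat.mod_lt _ hr0⟩ else ⟨0, hr0⟩ with hj
    have hTP := (hf1 j).2 q hq (hT.lt q hq)
    rw [← hE] at hTP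
    unfold pathEdge at hTP ⊢
    rw [image_image] at hTP
    convert hTP using 1
    apply image_congr
    intro t ht
    have ht' : t < k := mem_range.1 (mem_coe.1 ht)
    simp only [Function.comp]
    rcases Nat.lt_or_ge (lam (s * (k-ℓ) + t)) (2*ℓ) with h1 | h1
    · rw [wroot _ h1]
      simp only [ext, h1, if_true]
    · obtain ⟨h', he⟩ := wint _ (by omega) h1
      rw [he]
      unfold ext
      rw [if_neg (by omega), dif_pos h']
      congr 2
      have hex : ∃ t', t' < k ∧ lam (s * (k-ℓ) + t') = (lam (s * (k-ℓ) + t) - 2*ℓ) + 2*ℓ :=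
        ⟨t, ht', by omega⟩
      simp only [hj]
      rw [dif_pos hex]
      have hsp := hex.choose_spec
      have : hex.choose = t := hinj (by simpa using hsp.1) (by simpa using ht') (by
        simp only; rw [hsp.2]; omega)
      rw [this]
  · intro p hp p' hp' hpp
    simp only [Set.mem_Iio] at hp hp'
    have tri : ∀ p, p < r → (p < ℓ ∧ w p = A p) ∨ (ℓ ≤ p ∧ p < r - ℓ) ∨ 
        (∃ i < ℓ, p = r - ℓ + i ∧ w p = B i) := by
      intro p hp
      by_cases h1 : p < ℓ
      · exact Or.inl ⟨h1, wA p h1⟩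
      · by_cases h2 : p < r - ℓ
        · exact Or.inr (Or.inl ⟨by omega, h2⟩)
        · refine Or.inr (Or.inr ⟨p - (r - ℓ), by omega, by omega, ?_⟩)
          rw [← wB _ (by omega)]; congr 1; omega
    rcases tri p hp with ⟨h1, e1⟩ | ⟨h1, h1'⟩ | ⟨i, hi, rfl, e1⟩ <;>
      rcases tri p' hp' with ⟨h2, e2⟩ | ⟨h2, h2'⟩ | ⟨i', hi', rfl, e2⟩
    · rw [e1, e2] at hpp; exact hA h1 h2 hpp
    · exact absurd (hpp ▸ e1 ▸ AW p h1 : w p' ∈ W') (wI p' h2 h2')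
    · rw [e1, e2] at hpp; exact absurd hpp (hAB _ h1 _ hi')
    · exact absurd (hpp ▸ e2 ▸ AW p' h2 : w p ∈ W') (wI p h1 h1')
    · obtain ⟨a1, ha1⟩ := wint p hp (hw3 p h1 h1')
      obtain ⟨a2, ha2⟩ := wint p' hp' (hw3 p' h2 h2')
      rw [ha1, ha2] at hpp
      have := hf2 hpp
      simp only [Prod.mk.injEq, Fin.mk.injEq] at this
      rw [Nat.mod_eq_of_lt hp, Nat.mod_eq_of_lt hp'] at this
      exact this.2
    · exact absurd (hpp ▸ e2 ▸ BW i' hi' : w p ∈ W') (wI p h1 h1')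
    · rw [e1, e2] at hpp; exact absurd hpp.symm (hAB _ h2 _ hi)
    · refine absurd ?_ (wI p' h2 h2')
      rw [← hpp, e1]; exact BW i hi
    · rw [e1, e2] at hpp
      rw [hB hi hi' hpp]

end AbsPath

open Finset
namespace AbsPath

lemma edge_lemma {n k T : ℕ} {H : Finset (Finset (Fin n))} {f : Fin k × Fin T → Fin n}
    (hf : ∀ j : Fin k → Fin T, univ.image (fun i => f (i, j i)) ∈ H) (g : ℕ → Fin k × Fin T)
    (hg : (range k).image (fun t => ((g t).1 : ℕ)) = range k) :
    (range k).image (fun t => f (g t)) ∈ H := by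
  classical
  have hinj : Set.InjOn (fun t => ((g t).1 : ℕ)) (range k : Finset ℕ) := by
    rw [← card_image_iff, hg]
  have hex : ∀ i : Fin k, ∃ t, t < k ∧ (g t).1 = i := by
    intro i
    have : (i : ℕ) ∈ (range k).image (fun t => ((g t).1 : ℕ)) := by rw [hg]; simp
    obtain ⟨t, ht, he⟩ := mem_image.1 this
    exact ⟨t, mem_range.1 ht, Fin.ext he⟩
  choose tt htt hgt using hex
  have := hf (fun i => (g (tt i)).2)
  convert this using 1
  ext x
  simp only [mem_image, mem_range, mem_univ, true_and]
  constructor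
  · rintro ⟨t, ht, rfl⟩
    refine ⟨(g t).1, ?_⟩
    have : tt (g t).1 = t := hinj (by simpa using htt _) (by simpa using ht) (by simp [hgt])
    rw [this]
  · rintro ⟨i, rfl⟩
    refine ⟨tt i, htt i, ?_⟩
    congr 1
    apply Prod.ext
    · exact hgt i
    · rfl

lemma fixup {α C : Type} [DecidableEq α] (col qc : α → C) (π : Equiv.Perm α)
    (hπ : ∀ t, col (π t) = qc t) (h : α → α) (A : Finset α) (hinj : Set.InjOn h A)
    (hh : ∀ a ∈ A, col (h a) = qc a) :
    ∃ π' : Equiv.Perm α, (∀ t, col (π' t) = qc t) ∧ ∀ a ∈ A, π' a = h a := by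
  induction A using Finset.induction_on with
  | empty => exact ⟨π, hπ, by simp⟩
  | insert a0 A ha ih =>
    obtain ⟨π', h1, h2⟩ := ih (hinj.mono (by simp)) (fun a ha => hh a (mem_insert_of_mem ha))
    refine ⟨π'.trans (Equiv.swap (π' a0) (h a0)), ?_, ?_⟩
    · intro t
      simp only [Equiv.trans_apply]
      rcases Equiv.swap_apply_eq_iff.1 (rfl : Equiv.swap (π' a0) (h a0) (π' t) = _) with _
      by_cases e1 : π' t = π' a0
      · rw [e1, Equiv.swap_apply_left, hh a0 (mem_insert_self _ _), π'.injective e1]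
      · by_cases e2 : π' t = h a0
        · rw [e2, Equiv.swap_apply_right, h1, ← h1 t, e2, hh a0 (mem_insert_self _ _)]
        · rw [Equiv.swap_apply_of_ne_of_ne e1 e2, h1]
    · intro a haA
      simp only [Equiv.trans_apply]
      rcases mem_insert.1 haA with rfl | haA'
      · rw [Equiv.swap_apply_left]
      · have hne : a ≠ a0 := by rintro rfl; exact ha haA'
        have e1 : π' a ≠ π' a0 := fun h => hne (π'.injective h)
        have e2 : π' a ≠ h a0 := by
          rw [h2 a haA']
          intro he
          exact hne (hinj (mem_coe.2 haA) (mem_coe.2 (mem_insert_self _ _)) he)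
        rw [Equiv.swap_apply_of_ne_of_ne e1 e2, h2 a haA']

lemma card_pullback {ι κ V : Type} [Fintype ι] [Fintype κ] [Fintype V] (σ : κ → ι)
    (hσ : Function.Injective σ) (Q : (κ → V) → Prop) :
    Nat.card {f : ι → V // Q (f ∘ σ)} ≤
      Nat.card {g : κ → V // Q g} * Fintype.card V ^ (Fintype.card ι - Fintype.card κ) := by
  classical
  have hc : Nat.card ({x : ι // x ∉ Set.range σ} → V) = Fintype.card V ^ (Fintype.card ι - Fintype.card κ) := by
    rw [Nat.card_fun, Nat.card_eq_fintype_card, Nat.card_eq_fintype_card]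
    congr 1
    rw [Fintype.card_subtype_compl]
    congr 1
    exact Set.card_range_of_injective hσ
  rw [← hc, ← Nat.card_prod]
  apply Nat.card_le_card_of_injective (fun f => (⟨f.1 ∘ σ, f.2⟩, fun x => f.1 x.1))
  rintro ⟨f, hf⟩ ⟨f', hf'⟩ he
  simp only [Prod.mk.injEq, Subtype.mk.injEq] at he
  apply Subtype.ext
  funext x
  by_cases hx : x ∈ Set.range σ
  · obtain ⟨y, rfl⟩ := hx
    exact congrFun he.1 y
  · exact congrFun he.2 ⟨x, hx⟩

lemma card_split {V : Type} [Fintype V] (b d : ℕ) (Q : (Fin b → V) → (Fin d → V) → Prop) {B : ℝ}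
    (hQ : ∀ y, (Nat.card {x // Q x y} : ℝ) ≤ B) :
    (Nat.card {g : Fin (b + d) → V // Q (fun i => g (Fin.castAdd d i)) (fun i => g (Fin.natAdd b i))} : ℝ)
      ≤ (Fintype.card V : ℝ) ^ d * B := by
  classical
  have e : Nat.card {g : Fin (b + d) → V // Q (fun i => g (Fin.castAdd d i)) (fun i => g (Fin.natAdd b i))}
      ≤ Nat.card (Σ y : Fin d → V, {x // Q x y}) := by
    apply Nat.card_le_card_of_injective (fun g => ⟨fun i => g.1 (Fin.natAdd b i), 
      ⟨fun i => g.1 (Fin.castAdd d i), g.2⟩⟩)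
    rintro ⟨g, hg⟩ ⟨g', hg'⟩ he
    simp only [Sigma.mk.injEq] at he
    obtain ⟨h1, h2⟩ := he
    have h3 : (fun i => g (Fin.castAdd d i)) = (fun i => g' (Fin.castAdd d i)) := by
      have key : ∀ (y y' : Fin d → V) (hy : y = y') (x : {x // Q x y}) (x' : {x // Q x y'}), HEq x x' → x.1 = x'.1 := by
        rintro y _ rfl x x' h; rw [eq_of_heq h]
      exact key _ _ h1 _ _ h2
    apply Subtype.ext
    funext i
    refine Fin.addCases (fun i => ?_) (fun i => ?_) i
    · exact congrFun h3 i
    · exact congrFun h1 i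
  calc (Nat.card {g : Fin (b + d) → V // Q (fun i => g (Fin.castAdd d i)) (fun i => g (Fin.natAdd b i))} : ℝ)
      ≤ (Nat.card (Σ y : Fin d → V, {x // Q x y}) : ℝ) := by exact_mod_cast e
    _ = ∑ y, (Nat.card {x // Q x y} : ℝ) := by rw [Nat.card_sigma]; push_cast; rfl
    _ ≤ ∑ y : Fin d → V, B := sum_le_sum (fun y _ => hQ y)
    _ = _ := by simp

/-- length of the absorbing gadgets -/
def bb (k ℓ : ℕ) : ℕ := k + ℓ * (k-1) * k * (k-ℓ)

lemma bb_le {k ℓ : ℕ} (hl : 0 < ℓ) (hlk : ℓ < k) : bb k ℓ ≤ k ^ 4 := by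
  unfold bb
  obtain ⟨m, rfl⟩ : ∃ m, k = m + 1 := ⟨k - 1, by omega⟩
  have h1 : ℓ ≤ m := by omega
  have h2 : m + 1 - ℓ ≤ m := by omega
  have : ℓ * (m + 1 - 1) * (m+1) * (m + 1 - ℓ) ≤ m * m * (m+1) * m := by
    gcongr
    simp
  nlinarith [Nat.zero_le (m^3), Nat.zero_le (m^2)]

end AbsPath

open Finset
namespace AbsPath

/-- edges whose last `k-ℓ` vertices form a set in `𝓑` -/
def RR {n k : ℕ} (ℓ : ℕ) (H 𝓑 : Finset (Finset (Fin n))) (x : Fin k → Fin n) : Prop :=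
  univ.image x ∈ H ∧ (univ.filter (fun i : Fin k => ℓ ≤ (i:ℕ))).image x ∈ 𝓑

lemma rr_count {n k ℓ : ℕ} (hl : 0 < ℓ) (hlk : ℓ < k) {H 𝓑 : Finset (Finset (Fin n))}
    (hH : IsKGraph n k H) {x C : ℝ} (hd : MinDegreeGe n k H x) (hC0 : 0 ≤ C)
    (hC1 : C + k ≤ x) (hC2 : C + k ≤ n) (h𝓑 : ∀ S ∈ 𝓑, S.card = k - ℓ) :
    𝓑.card * C ^ ℓ ≤ Nat.card {x : Fin k → Fin n // RR ℓ H 𝓑 x} := by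
  classical
  have hk1 : k - ℓ + ℓ = k := by omega
  have hT : Tmpl k (k-ℓ) (k-ℓ+ℓ) 1 (fun _ => range k) (fun _ => k - 1) := by
    refine ⟨by simp, ?_, ?_, ?_, ?_, ?_⟩
    · intro q _; simp; omega
    · intro q _ x hx; simp at hx; omega
    · intro q _; omega
    · intro q _; omega
    · intro q hq q' hq' _; omega
  have hn : 0 < n := by
    by_contra h
    have : (n:ℝ) = 0 := by exact_mod_cast (by omega : n = 0)
    have h2 : (0:ℝ) < k := by exact_mod_cast (by omega : 0 < k)
    linarith
  have hroot : ∀ S : 𝓑, ∃ root : ℕ → Fin n, Set.InjOn root (Set.Iio (k-ℓ)) ∧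
      (range (k-ℓ)).image root = S.1 := by
    intro S
    have hc := h𝓑 S.1 S.2
    set e := S.1.equivFinOfCardEq hc with he
    refine ⟨fun i => if h : i < k - ℓ then (e.symm ⟨i, h⟩ : Fin n) else ⟨0, hn⟩, ?_, ?_⟩
    · intro a ha b hb hab
      simp only [Set.mem_Iio] at ha hb
      simp only [ha, hb, dif_pos] at hab
      have := e.symm.injective (Subtype.ext hab)
      simpa using this
    · ext z
      simp only [mem_image, mem_range]
      constructor
      · rintro ⟨a, ha, rfl⟩
        simp only [ha, dif_pos]
        exact (e.symm ⟨a, ha⟩).2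
      · intro hz
        refine ⟨e ⟨z, hz⟩, (e ⟨z, hz⟩).2, ?_⟩
        simp
  choose root hr1 hr2 using hroot
  have hcnt : ∀ S : 𝓑, C ^ ℓ ≤ Nat.card {y : Fin ℓ → Fin n // TP (k-ℓ) 1 (fun _ => range k) (fun _ => k-1) H (root S) ℓ y} := by
    intro S
    have hkc : ((k - ℓ : ℕ) : ℝ) + ℓ = k := by exact_mod_cast hk1
    exact tp_count hT (by omega) hH hd hC0 (by rw [hkc]; exact hC1) (by rw [hkc]; exact hC2) (hr1 S)
  have h1 : (𝓑.card : ℝ) * C^ℓ ≤ Nat.card (Σ S : 𝓑, {y : Fin ℓ → Fin n // TP (k-ℓ) 1 (fun _ => range k) (fun _ => k-1) H (root S) ℓ y}) := by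
    rw [Nat.card_sigma]; push_cast
    have : (𝓑.card : ℝ) * C^ℓ = ∑ S : 𝓑, C^ℓ := by simp
    rw [this]
    exact sum_le_sum (fun S _ => hcnt S)
  refine h1.trans ?_
  norm_cast
  -- the position map
  set φ : ℕ → ℕ := fun i => if i < ℓ then i + (k-ℓ) else i - ℓ with hφ
  have hφ1 : ∀ i, i < ℓ → φ i = i + (k-ℓ) := fun i hi => by simp only [hφ, hi, if_true]
  have hφ2 : ∀ i, ℓ ≤ i → φ i = i - ℓ := fun i hi => by
    simp only [hφ]; rw [if_neg (by omega)]
  have hlast : ∀ (S : 𝓑) (y : Fin ℓ → Fin n), (univ.filter (fun i : Fin k => ℓ ≤ (i:ℕ))).image 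
      (fun i : Fin k => ext (k-ℓ) (root S) y (φ i)) = S.1 := by
    intro S y
    rw [← hr2 S]
    ext z
    simp only [mem_image, mem_filter, mem_univ, true_and, mem_range]
    constructor
    · rintro ⟨i, hi, rfl⟩
      have hi2 := i.2
      refine ⟨i - ℓ, by omega, ?_⟩
      rw [hφ2 _ hi]
      simp only [ext]
      rw [if_pos (by omega)]
    · rintro ⟨a, ha, rfl⟩
      refine ⟨⟨a + ℓ, by omega⟩, by simp, ?_⟩
      rw [hφ2 _ (by simp)]
      simp only [ext]
      rw [if_pos (by simpa using ha)]
      simp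
  have hmem : ∀ p : (Σ S : 𝓑, {y : Fin ℓ → Fin n // TP (k-ℓ) 1 (fun _ => range k) (fun _ => k-1) H (root S) ℓ y}),
      RR ℓ H 𝓑 (fun i : Fin k => ext (k-ℓ) (root p.1) p.2.1 (φ i)) := by
    intro p
    refine ⟨?_, by rw [hlast]; exact p.1.2⟩
    have := p.2.2.2 0 (by omega) (by show k - 1 < _; omega)
    convert this using 1
    ext z
    simp only [mem_image, mem_univ, true_and, mem_range]
    constructor
    · rintro ⟨i, rfl⟩
      have := i.2
      refine ⟨φ i, ?_, rfl⟩
      simp only [hφ]; split_ifs <;> omega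
    · rintro ⟨a, ha, rfl⟩
      by_cases h : a < k - ℓ
      · refine ⟨⟨a + ℓ, by omega⟩, ?_⟩
        congr 1
        simp [hφ]
      · refine ⟨⟨a - (k-ℓ), by omega⟩, ?_⟩
        congr 1
        simp only [hφ]; split_ifs <;> omega
  apply Nat.card_le_card_of_injective (f := fun p => (⟨fun i : Fin k => ext (k-ℓ) (root p.1) p.2.1 (φ i), hmem p⟩ :
      {x : Fin k → Fin n // RR ℓ H 𝓑 x}))
  · rintro ⟨S, y, hy⟩ ⟨S', y', hy'⟩ he
    simp only [Subtype.mk.injEq] at he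
    have hS : S = S' := by
      apply Subtype.ext
      rw [← hlast S y, ← hlast S' y', he]
    subst hS
    have hyy : y = y' := by
      funext i
      have := congrFun he ⟨i, by omega⟩
      rw [hφ1 _ i.2] at this
      simpa [ext] using this
    subst hyy
    rfl

/-- colour of a position -/
def pcol (k ℓ b p : ℕ) : ℕ := if p < b then p % k else ℓ + (p - b)

lemma pcol_lt {k ℓ b p : ℕ} (hlk : ℓ < k) (hp : p < b + (k-ℓ)) : pcol k ℓ b p < k := by
  unfold pcol
  split_ifs
  · exact Nat.mod_lt _ (by omega)
  · omega

/-- the section of the blow-up -/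
def sec (k ℓ b : ℕ) (hlk : ℓ < k) (p : Fin (b + (k-ℓ))) : Fin k × Fin (b + (k-ℓ)) :=
  (⟨pcol k ℓ b p, pcol_lt hlk p.2⟩, p)

lemma gadget {n k ℓ b : ℕ} (hbdef : b = k + ℓ * (k-1) * k * (k-ℓ)) (hl : 0 < ℓ) (hlk : ℓ + 2 ≤ k) (hlk' : ℓ < k) (hnd : ¬ (k - ℓ) ∣ k) 
    {H : Finset (Finset (Fin n))} {f : Fin k × Fin (b + (k-ℓ)) → Fin n}
    (hf : ∀ j : Fin k → Fin (b + (k-ℓ)), univ.image (fun i => f (i, j i)) ∈ H)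
    (hinj : Function.Injective f) : 
    ∃ u : ℕ → Fin n, (∀ i : Fin (b), u i = f (sec k ℓ (b) hlk' (Fin.castAdd _ i))) ∧
      IsAbsorbingSeq n k ℓ (b) H
        (univ.image (fun i : Fin (k-ℓ) => f (sec k ℓ (b) hlk' (Fin.natAdd _ i)))) u := by
  classical
  obtain ⟨P, hP⟩ := exists_reach (k := k) (d := k - ℓ) (by omega) (by omega) hnd ℓ
  have hm : k ≤ ℓ * (k-1) * k * (k-ℓ) := by
    have h1 : 1 ≤ ℓ * (k-1) := Nat.mul_pos hl (by omega)
    calc k = 1 * k * 1 := by ring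
      _ ≤ ℓ * (k-1) * k * (k-ℓ) := by gcongr; omega
  have hbk : k ∣ b := by
    rw [hbdef]
    exact dvd_add dvd_rfl (Dvd.dvd.mul_right (Dvd.dvd.mul_left dvd_rfl _) _)
  have hb2 : 2 * k ≤ b := by omega
  have hbd : (k-ℓ) ∣ b - k := ⟨ℓ * (k-1) * k, by rw [hbdef, Nat.add_sub_cancel_left, mul_comm]⟩
  have hbd' : (k-ℓ) ∣ b + (k-ℓ) - k := by
    rw [show b + (k-ℓ) - k = (b - k) + (k-ℓ) by omega]
    exact dvd_add hbd dvd_rfl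
  have hT0 : 0 < (b + (k-ℓ)) := by omega
  have htail : ∀ t, b - k ≤ t → P t % k = (t % k + ℓ) % k := fun t ht => hP.tail t (by omega)
  have hbmod : ∀ r, (b + r) % k = r % k := by
    intro r; obtain ⟨z, hz⟩ := hbk; rw [hz, Nat.mul_add_mod]
  have hbmod' : ∀ r, (b - k + r) % k = r % k := by
    intro r; obtain ⟨z, hz⟩ := hbk
    have : z * k = (z - 1) * k + k := by
      have : 1 ≤ z := by
        rcases Nat.eq_zero_or_pos z with h | h
        · subst h; omega
        · exact h
      rw [← Nat.succ_mul]; congr 1; omega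
    rw [show b - k + r = k * (z-1) + r by rw [hz, mul_comm k z, this, mul_comm k]; omega, Nat.mul_add_mod]
  -- initial permutation
  set pi0 : Fin (b + (k-ℓ)) → Fin (b + (k-ℓ)) := fun t => if h : (t:ℕ) < b then ⟨P t, by have := hP.pres b t hbk h; omega⟩ else t with hpi0
  have hpii : Function.Injective pi0 := by
    intro s t hst
    simp only [hpi0] at hst
    split_ifs at hst with h1 h2 h2
    · exact Fin.ext (hP.inj (by simpa using hst))
    · exfalso
      have := hP.pres b s hbk h1
      have h3 : P s = t := by rw [← hst]
      omega
    · exfalso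
      have := hP.pres b t hbk h2
      have h3 : P t = s := by rw [hst]
      omega
    · exact hst
  set π := Equiv.ofBijective pi0 (Finite.injective_iff_bijective.1 hpii) with hπ
  have hπc : ∀ t : Fin (b + (k-ℓ)), pcol k ℓ b (π t) = P t % k := by
    intro t
    simp only [hπ, Equiv.ofBijective_apply, hpi0]
    split_ifs with h
    · have := hP.pres b t hbk h
      simp only [pcol]
      rw [if_pos this]
    · have ht := t.2
      simp only [pcol]
      rw [if_neg h, htail t (by omega)]
      obtain ⟨r, hr⟩ : ∃ r, (t:ℕ) = b + r := ⟨t - b, by omega⟩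
      rw [hr, hbmod, Nat.mod_eq_of_lt (by omega : r < k), Nat.mod_eq_of_lt (by omega : r + ℓ < k)]
      omega
  -- fix the ends
  set h : Fin (b + (k-ℓ)) → Fin (b + (k-ℓ)) := fun t => if h : (t:ℕ) < b + (k-ℓ) - ℓ then t else ⟨t - (k-ℓ), by omega⟩ with hh
  obtain ⟨π', hπ1, hπ2⟩ := fixup (fun t : Fin (b + (k-ℓ)) => pcol k ℓ b t) (fun t => P t % k) π hπc h
    (univ.filter (fun t : Fin (b + (k-ℓ)) => (t:ℕ) < ℓ ∨ b + (k-ℓ) - ℓ ≤ t)) (by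
      intro s hs t ht hst
      simp only [coe_filter, mem_univ, true_and, Set.mem_ofPred_eq] at hs ht
      simp only [hh] at hst
      apply Fin.ext
      split_ifs at hst with h1 h2 h2
      · rw [hst]
      · have : (s:ℕ) = t - (k-ℓ) := by rw [hst]
        omega
      · have : (t:ℕ) = s - (k-ℓ) := by rw [← hst]
        omega
      · have : (s:ℕ) - (k-ℓ) = t - (k-ℓ) := by simpa using hst
        omega) (by
      intro t ht
      simp only [mem_filter, mem_univ, true_and] at ht
      simp only [hh]
      split_ifs with h1
      · have h2 : (t:ℕ) < ℓ := by omega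
        rw [hP.start t (by omega)]
        simp only [pcol]
        rw [if_pos (by omega)]
      · obtain ⟨i, hi⟩ : ∃ i, (t:ℕ) = b + (k-ℓ) - ℓ + i := ⟨t - (b + (k-ℓ) - ℓ), by omega⟩
        have ht2 := t.2
        have hi' : i < ℓ := by omega
        simp only [pcol]
        rw [if_pos (by omega), htail t (by omega)]
        rw [show (t:ℕ) - (k-ℓ) = b - k + ((k-ℓ) + i) by omega, hbmod', Nat.mod_add_mod,
          show (t:ℕ) + ℓ = b + ((k-ℓ) + i) by omega, hbmod])
  -- vertices
  set g : ℕ → Fin (b + (k-ℓ)) := fun p => ⟨p % (b + (k-ℓ)), Nat.mod_lt _ hT0⟩ with hg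
  have hgv : ∀ p (hp : p < (b + (k-ℓ))), g p = ⟨p, hp⟩ := fun p hp => Fin.ext (Nat.mod_eq_of_lt hp)
  have hsi : Function.Injective (sec k ℓ b hlk') := fun p q hpq => congrArg Prod.snd hpq
  set F : Fin (b + (k-ℓ)) → Fin n := fun p => f (sec k ℓ b hlk' p) with hF
  have hFi : Function.Injective F := hinj.comp hsi
  refine ⟨fun p => F (g p), ?_, ⟨by omega, hbd, ?_, ?_⟩, ?_, ?_⟩
  · intro i
    have := i.2
    simp only [hF]
    rw [hgv _ (by omega)]; rfl
  · intro p hp q hq hpq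
    simp only [Set.mem_Iio] at hp hq
    have := hFi hpq
    rw [hgv _ (by omega), hgv _ (by omega)] at this
    simpa using this
  · intro s hs
    apply edge_lemma hf (fun t => sec k ℓ b hlk' (g (s * (k-ℓ) + t)))
    -- periodic colouring
    have e : (range k).image (fun t => ((sec k ℓ b hlk' (g (s * (k-ℓ) + t))).1 : ℕ)) =
        (range k).image (fun t => (s * (k-ℓ) + t) % k) := by
      apply image_congr
      intro t ht
      have ht' : t < k := mem_range.1 (mem_coe.1 ht)
      simp only [sec]
      rw [hgv _ (by omega)]
      simp only [pcol]
      rw [if_pos (by omega)]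
    rw [e]
    apply Finset.eq_of_subset_of_card_le
    · intro z hz
      obtain ⟨t, _, rfl⟩ := mem_image.1 hz
      exact mem_range.2 (Nat.mod_lt _ (by omega))
    · rw [card_image_of_injOn]
      intro t ht t' ht' htt
      simp only [coe_range, Set.mem_Iio] at ht ht'
      have : t ≡ t' [MOD k] := Nat.ModEq.add_left_cancel' _ htt
      exact Nat.ModEq.eq_of_lt_of_lt this ht ht'
  · intro i hi hmem
    obtain ⟨r, _, hr⟩ := mem_image.1 hmem
    have := hFi hr
    rw [hgv _ (by omega)] at this
    have h2 := congrArg Fin.val this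
    simp at h2
    omega
  · refine ⟨fun t => F (π' (g t)), ⟨by omega, hbd', ?_, ?_⟩, ?_, ?_, ?_⟩
    · intro p hp q hq hpq
      simp only [Set.mem_Iio] at hp hq
      have := π'.injective (hFi hpq)
      rw [hgv _ hp, hgv _ hq] at this
      simpa using this
    · intro s hs
      apply edge_lemma hf (fun t => sec k ℓ b hlk' (π' (g (s * (k-ℓ) + t))))
      refine Eq.trans ?_ (Reach.window (by omega) hP s)
      apply image_congr
      intro t ht
      have ht' : t < k := mem_range.1 (mem_coe.1 ht)
      have := hπ1 (g (s * (k-ℓ) + t))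
      simp only [sec]
      rw [this, hgv _ (by omega)]
    · ext z
      simp only [mem_image, mem_union, mem_range, mem_univ, true_and]
      constructor
      · rintro ⟨t, ht, rfl⟩
        by_cases hc : ((π' (g t) : Fin (b + (k-ℓ))) : ℕ) < b
        · left
          refine ⟨_, hc, ?_⟩
          congr 1
          rw [hgv _ (by omega)]
        · right
          have h2 := (π' (g t)).2
          refine ⟨⟨(π' (g t) : Fin (b + (k-ℓ))) - b, by omega⟩, ?_⟩
          simp only [hF]
          congr 2
          apply Fin.ext
          simp; omega
      · have key : ∀ p : Fin (b + (k-ℓ)), ∃ t < b + (k-ℓ), F (π' (g t)) = F p := by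
          intro p
          refine ⟨π'.symm p, (π'.symm p).2, ?_⟩
          rw [hgv _ (π'.symm p).2]
          simp
        rintro (⟨i, hi, rfl⟩ | ⟨i, rfl⟩)
        · exact key _
        · exact key _
    · intro i hi
      simp only
      rw [hπ2 _ (by
        simp only [mem_filter, mem_univ, true_and]
        left; rw [hgv _ (by omega)]; exact hi)]
      congr 1
      simp only [hh]
      rw [dif_pos]
      rw [hgv _ (by omega)]
      simp only
      omega
    · intro i hi
      simp only
      rw [hπ2 _ (by
        simp only [mem_filter, mem_univ, true_and]
        right; rw [hgv _ (by omega)]; simp only; omega)]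
      congr 1
      simp only [hh]
      rw [hgv (b - ℓ + i) (by omega), hgv _ (by omega), dif_neg]
      · apply Fin.ext; simp only; omega
      · simp only; omega

end AbsPath

open Finset
namespace AbsPath

open scoped Classical in
lemma most_good {k ℓ : ℕ} (hl : 0 < ℓ) (hlk : ℓ + 2 ≤ k) (hnd : ¬ (k - ℓ) ∣ k) (μ γ' : ℝ)
    (hμ : 0 < μ) (hγ : 0 < γ') :
    ∃ c0 : ℝ, 0 < c0 ∧ ∃ n0 : ℕ, ∀ c : ℝ, 0 ≤ c → c ≤ c0 → ∀ n ≥ n0, ∀ H : Finset (Finset (Fin n)),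
      IsKGraph n k H → MinDegreeGe n k H (μ * n) →
      ((((univ : Finset (Fin n)).powersetCard (k-ℓ)).filter (fun S => ¬ CGood n k ℓ (bb k ℓ) H c S)).card : ℝ)
        ≤ γ' * (n : ℝ) ^ (k-ℓ) := by
  obtain ⟨b, hb⟩ : ∃ b, b = bb k ℓ := ⟨_, rfl⟩
  rw [← hb]
  have hlk' : ℓ < k := by omega
  set κ : ℝ := min μ 1 / 2 with hκ
  have hκ0 : 0 < κ := by positivity
  obtain ⟨T, hT⟩ : ∃ T, T = b + (k-ℓ) := ⟨_, rfl⟩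
  obtain ⟨c1, hc1⟩ : ∃ c1 : ℝ, c1 = (γ' * κ ^ ℓ) ^ (T ^ k) := ⟨_, rfl⟩
  have hc10 : 0 < c1 := by rw [hc1]; positivity
  obtain ⟨n1, hn1⟩ := exists_big κ (k + 1) hκ0
  obtain ⟨n2, hn2⟩ := exists_big (c1/2) (((k * T : ℕ) : ℝ)^2 + 1) (by positivity)
  refine ⟨c1 / 2, by positivity, max n1 n2, ?_⟩
  intro c hc hcc n hn H hH hd
  have hn1 := hn1 n (le_trans (le_max_left _ _) hn)
  have hn2 := hn2 n (le_trans (le_max_right _ _) hn)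
  set 𝓑 := ((univ : Finset (Fin n)).powersetCard (k-ℓ)).filter (fun S => ¬ CGood n k ℓ b H c S) with h𝓑
  by_contra hcon
  push Not at hcon
  have hκμ : 2 * κ ≤ μ := by rw [hκ]; linarith [min_le_left μ 1]
  have hκ1 : 2 * κ ≤ 1 := by rw [hκ]; linarith [min_le_right μ 1]
  have hn0 : (0:ℝ) ≤ n := by positivity
  have hnp : (0:ℝ) < n := by
    rcases hn0.eq_or_lt with h | h
    · rw [← h] at hn1
      have : (0:ℝ) ≤ k := by positivity
      linarith
    · exact h
  have h1 := rr_count (C := κ * n) hl hlk' (𝓑 := 𝓑) hH hd (by positivity) (by nlinarith) (by nlinarith)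
    (fun S hS => (mem_powersetCard.1 (mem_filter.1 hS).1).2)
  have h2 : (γ' * κ ^ ℓ) * (Nat.card (Fin n) : ℝ) ^ k ≤ Nat.card {x : Fin k → Fin n // RR ℓ H 𝓑 x} := by
    refine le_trans ?_ h1
    rw [Nat.card_fin]
    calc (γ' * κ ^ ℓ) * (n : ℝ) ^ k = (γ' * (n:ℝ)^(k-ℓ)) * (κ * n)^ℓ := by
          have : (n:ℝ)^k = (n:ℝ)^(k-ℓ) * (n:ℝ)^ℓ := by rw [← pow_add]; congr 1; omega
          rw [this, mul_pow]; ring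
      _ ≤ _ := by gcongr
  have hT1 : 1 ≤ T := by omega
  have h3 := blow (t := T) hT1 k (RR ℓ H 𝓑) (by positivity) h2
  rw [← hc1] at h3
  have h4 := good_maps ∅ _ h3
  simp only [Fintype.card_prod, Fintype.card_fin, card_empty, Nat.cast_zero, mul_zero, add_zero, Nat.card_fin] at h4
  subst hT
  -- upper bound
  set Qx : (Fin b → Fin n) → (Fin (k-ℓ) → Fin n) → Prop := fun x y =>
    univ.image y ∈ 𝓑 ∧ ∃ u : ℕ → Fin n, (∀ i : Fin b, u i = x i) ∧
      IsAbsorbingSeq n k ℓ b H (univ.image y) u with hQx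
  have h5 : ∀ y, (Nat.card {x // Qx x y} : ℝ) ≤ c * (n:ℝ)^b := by
    intro y
    by_cases hy : univ.image y ∈ 𝓑
    · have := (mem_filter.1 hy).2
      unfold CGood at this
      push Not at this
      refine le_trans (le_of_eq ?_) this.le
      rw [Nat.card_eq_fintype_card, Fintype.card_subtype]
      congr 2
      ext x
      simp only [hQx, hy, true_and, mem_filter, mem_univ]
    · have : IsEmpty {x // Qx x y} := ⟨fun x => hy x.2.1⟩
      rw [Nat.card_of_isEmpty]
      push_cast; positivity
  have h6 := card_split b (k-ℓ) Qx h5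
  set Q' : (Fin (b + (k-ℓ)) → Fin n) → Prop := fun g => Qx (fun i => g (Fin.castAdd _ i)) (fun i => g (Fin.natAdd b i)) with hQ'
  have h7 := card_pullback (V := Fin n) (sec k ℓ b hlk') (fun p q hpq => congrArg Prod.snd hpq) Q'
  simp only [Fintype.card_prod, Fintype.card_fin] at h6 h7
  have h8 : Nat.card {g : Fin k × Fin (b + (k-ℓ)) → Fin n // (∀ j : Fin k → Fin (b + (k-ℓ)), RR ℓ H 𝓑 (fun i => g (i, j i))) ∧
      Function.Injective g ∧ ∀ i, g i ∉ (∅ : Finset (Fin n))} ≤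
      Nat.card {f : Fin k × Fin (b + (k-ℓ)) → Fin n // Q' (f ∘ sec k ℓ b hlk')} := by
    refine Nat.card_le_card_of_injective (fun f => ⟨f.1, ?_⟩) ?_
    · obtain ⟨f, hf1, hf2, -⟩ := f
      simp only [hQ', hQx, Function.comp]
      refine ⟨?_, gadget (hb.trans rfl) hl hlk hlk' hnd (fun j => (hf1 j).1) hf2⟩
      have := (hf1 (fun i => if h : ℓ ≤ (i:ℕ) then ⟨b + (i - ℓ), by omega⟩ else ⟨0, by omega⟩)).2
      convert this using 1
      ext z
      simp only [mem_image, mem_filter, mem_univ, true_and]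
      constructor
      · rintro ⟨r, rfl⟩
        have hr := r.2
        refine ⟨⟨ℓ + r, by omega⟩, by simp, ?_⟩
        congr 1
        simp only [sec, pcol]
        apply Prod.ext
        · apply Fin.ext; simp
        · apply Fin.ext; simp
      · rintro ⟨i, hi, rfl⟩
        have hi2 := i.2
        refine ⟨⟨i - ℓ, by omega⟩, ?_⟩
        congr 1
        simp only [sec, pcol]
        apply Prod.ext
        · apply Fin.ext; simp [hi]
        · apply Fin.ext; simp [hi]
    · rintro ⟨f, hf⟩ ⟨f', hf'⟩ he
      simpa using he
  have h9 : c1 * (n:ℝ)^((b + (k-ℓ)) * k) - ((k * (b + (k-ℓ)) : ℕ) : ℝ)^2 * (n:ℝ)^(k * (b + (k-ℓ)) - 1) ≤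
      ((n:ℝ)^(k-ℓ) * (c * (n:ℝ)^b)) * (n:ℝ)^(k * (b + (k-ℓ)) - (b + (k-ℓ))) := by
    refine h4.trans ?_
    have h10 : (Nat.card {f : Fin k × Fin (b + (k-ℓ)) → Fin n // Q' (f ∘ sec k ℓ b hlk')} : ℝ) ≤
      (Nat.card {g // Q' g} : ℝ) * (n:ℝ)^(k * (b + (k-ℓ)) - (b + (k-ℓ))) := by exact_mod_cast h7
    refine le_trans (by exact_mod_cast h8) (h10.trans ?_)
    gcongr
  have hkT : b + (k-ℓ) ≤ k * (b + (k-ℓ)) := Nat.le_mul_of_pos_left _ (by omega)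
  have e1 : ((n:ℝ)^(k-ℓ) * (c * (n:ℝ)^b)) * (n:ℝ)^(k * (b + (k-ℓ)) - (b + (k-ℓ))) = c * (n:ℝ)^(k * (b + (k-ℓ))) := by
    rw [show k * (b + (k-ℓ)) = (k - ℓ) + b + (k * (b + (k-ℓ)) - (b + (k-ℓ))) by omega, pow_add, pow_add]
    rw [show (k - ℓ) + b + (k * (b + (k-ℓ)) - (b + (k-ℓ))) = k * (b + (k-ℓ)) by omega]
    ring
  rw [e1, mul_comm (b + (k-ℓ)) k] at h9
  set K := k * (b + (k-ℓ)) with hK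
  obtain ⟨K', hK'⟩ : ∃ K', K = K' + 1 := ⟨K - 1, by omega⟩
  rw [hK'] at h9 hn2
  rw [Nat.add_sub_cancel, pow_succ] at h9
  have hp : (0:ℝ) < (n:ℝ)^K' := by positivity
  have h11 : c * n ≤ c1 / 2 * n := by gcongr
  have h12 : ((c1 * n - ((K' + 1 : ℕ) : ℝ)^2) - c * n) * (n:ℝ)^K' ≤ 0 := by linarith
  have h13 : 0 < (c1 * n - ((K' + 1 : ℕ) : ℝ)^2) - c * n := by linarith
  have := mul_pos h13 hp
  linarith

end AbsPath

open Finset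
namespace AbsPath

lemma glue_abs {n k ℓ r r' r1 r1' : ℕ} {H : Finset (Finset (Fin n))} {v u w u' : ℕ → Fin n}
    {X Y : Finset (Fin n)} (hlk : ℓ < k)
    (hv : IsPathSeq k ℓ r (· ∈ H) v) (hu : IsPathSeq k ℓ r' (· ∈ H) u)
    (hvu : ∀ i < ℓ, u i = v (r - ℓ + i)) (hdis : ∀ i < r, ∀ j, ℓ ≤ j → j < r' → v i ≠ u j)
    (hw : IsPathSeq k ℓ r1 (· ∈ H) w) (hu' : IsPathSeq k ℓ r1' (· ∈ H) u')
    (hwi : (range r1).image w = (range r).image v ∪ X)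
    (hui : (range r1').image u' = (range r').image u ∪ Y)
    (hw1 : ∀ i < ℓ, w i = v i) (hw2 : ∀ i < ℓ, w (r1 - ℓ + i) = v (r - ℓ + i))
    (hu1 : ∀ i < ℓ, u' i = u i) (hu2 : ∀ i < ℓ, u' (r1' - ℓ + i) = u (r' - ℓ + i))
    (hX1 : Disjoint X ((range r').image u)) (hY1 : Disjoint Y ((range r).image v))
    (hXY : Disjoint X Y) :
    IsPathSeq k ℓ (r1 + r1' - ℓ) (· ∈ H) (glue r1 ℓ w u') ∧
    (range (r1 + r1' - ℓ)).image (glue r1 ℓ w u') = (range (r + r' - ℓ)).image (glue r ℓ v u) ∪ (X ∪ Y) ∧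
    (∀ i < ℓ, glue r1 ℓ w u' i = glue r ℓ v u i) ∧
    (∀ i < ℓ, glue r1 ℓ w u' (r1 + r1' - ℓ - ℓ + i) = glue r ℓ v u (r + r' - ℓ - ℓ + i)) := by
  have hr := hv.1
  have hr' := hu.1
  have hr1 := hw.1
  have hr1' := hu'.1
  have hov : ∀ i < ℓ, u' i = w (r1 - ℓ + i) := by
    intro i hi; rw [hu1 i hi, hw2 i hi, hvu i hi]
  refine ⟨?_, ?_, ?_, ?_⟩
  · apply AbsPath.IsPathSeq.glue hlk hw hu' hov
    intro i hi j hj hjr he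
    have h1 : w i ∈ (range r).image v ∪ X := by rw [← hwi]; exact mem_image_of_mem _ (mem_range.2 hi)
    have h2 : u' j ∈ (range r').image u ∪ Y := by rw [← hui]; exact mem_image_of_mem _ (mem_range.2 hjr)
    rw [he] at h1
    rcases mem_union.1 h1 with h1 | h1 <;> rcases mem_union.1 h2 with h2 | h2
    · obtain ⟨p, hp, hpe⟩ := mem_image.1 h2
      obtain ⟨q, hq, hqe⟩ := mem_image.1 h1
      rcases Nat.lt_or_ge p ℓ with h3 | h3
      · rw [← hu1 p h3] at hpe
        have := hu'.2.2.1 (show p < r1' by omega) (show j < r1' from hjr) hpe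
        omega
      · exact hdis q (mem_range.1 hq) p h3 (mem_range.1 hp) (hqe.trans hpe.symm)
    · exact disjoint_left.1 hY1 h2 h1
    · exact disjoint_left.1 hX1 h1 h2
    · exact disjoint_left.1 hXY h1 h2
  · rw [image_glue (by omega) (by omega) hov, image_glue (by omega) (by omega) hvu, hwi, hui]
    ext z; simp only [mem_union]; tauto
  · intro i hi
    rw [glue_left (by omega), glue_left (by omega), hw1 i hi]
  · intro i hi
    rw [glue_last (by omega) (by omega) hov, glue_last (by omega) (by omega) hvu, hu2 i hi]

/-- a path with `t` absorbing segments -/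
structure Flex (n k ℓ b : ℕ) (H : Finset (Finset (Fin n))) (r : ℕ) (v : ℕ → Fin n) (t : ℕ)
    (g : ℕ → ℕ → Fin n) : Prop where
  path : IsPathSeq k ℓ r (· ∈ H) v
  flex : ∀ I : Finset ℕ, I ⊆ range t → ∀ S : ℕ → Finset (Fin n),
    (∀ i ∈ I, IsAbsorbingSeq n k ℓ b H (S i) (g i) ∧
      Disjoint (S i) ((range r).image v)) →
    (∀ i ∈ I, ∀ j ∈ I, i ≠ j → Disjoint (S i) (S j)) →
    ∃ w : ℕ → Fin n, IsPathSeq k ℓ (r + (k-ℓ) * I.card) (· ∈ H) w ∧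
      (range (r + (k-ℓ) * I.card)).image w = (range r).image v ∪ I.biUnion S ∧
      (∀ i < ℓ, w i = v i) ∧ (∀ i < ℓ, w (r + (k-ℓ) * I.card - ℓ + i) = v (r - ℓ + i))

lemma flex_zero {n k ℓ b : ℕ} {H : Finset (Finset (Fin n))} {r : ℕ} {v : ℕ → Fin n}
    {g : ℕ → ℕ → Fin n} (hv : IsPathSeq k ℓ r (· ∈ H) v) : Flex n k ℓ b H r v 0 g := by
  refine ⟨hv, ?_⟩
  intro I hI S _ _
  obtain rfl : I = ∅ := by simpa using hI
  exact ⟨v, by simpa using hv, by simp, by simp, by simp⟩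

lemma Flex.add {n k ℓ b : ℕ} {H : Finset (Finset (Fin n))} {r r' t : ℕ} {v u : ℕ → Fin n}
    {g : ℕ → ℕ → Fin n} (hlk : ℓ < k) (hF : Flex n k ℓ b H r v t g)
    (hu : IsPathSeq k ℓ r' (· ∈ H) u)
    (hvu : ∀ i < ℓ, u i = v (r - ℓ + i)) (hdis : ∀ i < r, ∀ j, ℓ ≤ j → j < r' → v i ≠ u j) :
    Flex n k ℓ b H (r + r' - ℓ) (glue r ℓ v u) t g := by
  have hr := hF.path.1
  have hr' := hu.1
  refine ⟨AbsPath.IsPathSeq.glue hlk hF.path hu hvu hdis, ?_⟩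
  intro I hI S hS hSS
  have him := image_glue (v := v) (w := u) (r := r) (r' := r') (by omega) (by omega) hvu
  rw [him] at hS
  obtain ⟨w, h1, h2, h3, h4⟩ := hF.flex I hI S (fun i hi => ⟨(hS i hi).1,
    (disjoint_union_right.1 (hS i hi).2).1⟩) hSS
  have hd : Disjoint (I.biUnion S) ((range r').image u) := by
    rw [disjoint_biUnion_left]
    exact fun i hi => (disjoint_union_right.1 (hS i hi).2).2
  obtain ⟨a1, a2, a3, a4⟩ := glue_abs (X := I.biUnion S) (Y := ∅) hlk hF.path hu hvu hdis h1 hu h2 (by simp) h3 h4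
    (fun _ _ => rfl) (fun _ _ => rfl) hd (by simp) (by simp)
  have e : r + r' - ℓ + (k-ℓ) * I.card = r + (k-ℓ) * I.card + r' - ℓ := by omega
  rw [e]
  exact ⟨_, a1, by rw [a2]; simp, a3, a4⟩

lemma Flex.addAbs {n k ℓ b : ℕ} {H : Finset (Finset (Fin n))} {r t : ℕ} {v u : ℕ → Fin n}
    {g : ℕ → ℕ → Fin n} (hlk : ℓ < k) (hF : Flex n k ℓ b H r v t g)
    (hu : IsPathSeq k ℓ b (· ∈ H) u)
    (hvu : ∀ i < ℓ, u i = v (r - ℓ + i)) (hdis : ∀ i < r, ∀ j, ℓ ≤ j → j < b → v i ≠ u j) :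
    Flex n k ℓ b H (r + b - ℓ) (glue r ℓ v u) (t+1) (Function.update g t u) := by
  have hr := hF.path.1
  have hr' := hu.1
  refine ⟨AbsPath.IsPathSeq.glue hlk hF.path hu hvu hdis, ?_⟩
  intro I hI S hS hSS
  have him := image_glue (v := v) (w := u) (r := r) (r' := b) (by omega) (by omega) hvu
  have hI' : I.erase t ⊆ range t := by
    intro i hi
    have h1 := mem_range.1 (hI (mem_of_mem_erase hi))
    have h2 := ne_of_mem_erase hi
    exact mem_range.2 (by omega)
  rw [him] at hS
  obtain ⟨w, h1, h2, h3, h4⟩ := hF.flex (I.erase t) hI' S (fun i hi => ⟨by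
      have := (hS i (mem_of_mem_erase hi)).1
      rwa [Function.update_of_ne (ne_of_mem_erase hi)] at this,
    (disjoint_union_right.1 (hS i (mem_of_mem_erase hi)).2).1⟩) 
    (fun i hi j hj => hSS i (mem_of_mem_erase hi) j (mem_of_mem_erase hj))
  have hd : Disjoint ((I.erase t).biUnion S) ((range b).image u) := by
    rw [disjoint_biUnion_left]
    exact fun i hi => (disjoint_union_right.1 (hS i (mem_of_mem_erase hi)).2).2
  by_cases ht : t ∈ I
  · obtain ⟨⟨b1, b2, u', b3, b4, b5, b6⟩, bd⟩ := hS t ht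
    rw [Function.update_self] at b1 b2 b4 b5 b6
    have hXY : Disjoint ((I.erase t).biUnion S) (S t) := by
      rw [disjoint_biUnion_left]
      exact fun i hi => hSS i (mem_of_mem_erase hi) t ht (ne_of_mem_erase hi)
    obtain ⟨a1, a2, a3, a4⟩ := glue_abs hlk hF.path hu hvu hdis h1 b3 h2 b4 h3 h4
      b5 b6 hd (disjoint_union_right.1 bd).1 hXY
    have hc : (k-ℓ) * I.card = (k-ℓ) * (I.erase t).card + (k-ℓ) := by
      rw [← card_erase_add_one ht]; ring
    have e : r + b - ℓ + (k-ℓ) * I.card = r + (k-ℓ) * (I.erase t).card + (b + (k-ℓ)) - ℓ := by omega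
    rw [e]
    refine ⟨_, a1, ?_, a3, a4⟩
    rw [a2]
    congr 1
    conv_rhs => rw [← insert_erase ht, biUnion_insert]
    rw [union_comm]
  · have hIe : I.erase t = I := erase_eq_of_notMem ht
    rw [hIe] at h1 h2 h4 hd
    obtain ⟨a1, a2, a3, a4⟩ := glue_abs (X := I.biUnion S) (Y := ∅) hlk hF.path hu hvu hdis h1 hu h2 (by simp) h3 h4
      (fun _ _ => rfl) (fun _ _ => rfl) hd (by simp) (by simp)
    have e : r + b - ℓ + (k-ℓ) * I.card = r + (k-ℓ) * I.card + b - ℓ := by omega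
    rw [e]
    exact ⟨_, a1, by rw [a2]; simp, a3, a4⟩

/-- the conclusion of the connecting lemma for one hypergraph -/
def Conn (n k ℓ L : ℕ) (H : Finset (Finset (Fin n))) (x : ℝ) : Prop :=
  ∀ A B : ℕ → Fin n, Set.InjOn A (Set.Iio ℓ) → Set.InjOn B (Set.Iio ℓ) →
        (∀ i < ℓ, ∀ j < ℓ, A i ≠ B j) → ∀ W : Finset (Fin n), (W.card : ℝ) ≤ x →
        ∃ v : ℕ → Fin n, IsPathSeq k ℓ L (· ∈ H) v ∧ (∀ i < ℓ, v i = A i) ∧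
          (∀ i < ℓ, v (L - ℓ + i) = B i) ∧ ∀ i, ℓ ≤ i → i < L - ℓ → v i ∉ W

lemma Flex.step {n k ℓ b L : ℕ} {H : Finset (Finset (Fin n))} {r r' t : ℕ} {v u : ℕ → Fin n}
    {g : ℕ → ℕ → Fin n} {x : ℝ} (hlk : ℓ < k) (hL : 2 * ℓ ≤ L) (hF : Flex n k ℓ b H r v t g)
    (hu : IsPathSeq k ℓ r' (· ∈ H) u) (hc : Conn n k ℓ L H x) (hx : (r : ℝ) + r' ≤ x)
    (hdis : ∀ i < r, ∀ j < r', v i ≠ u j) :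
    ∃ r2 v2, r2 ≤ r + L + r' ∧ (range r).image v ⊆ (range r2).image v2 ∧
      (range r').image u ⊆ (range r2).image v2 ∧ Flex n k ℓ b H r2 v2 t g ∧
      (r' = b → Flex n k ℓ b H r2 v2 (t+1) (Function.update g t u)) := by
  have hr := hF.path.1
  have hr' := hu.1
  obtain ⟨y, hy1, hy2, hy3, hy4⟩ := hc (fun i => v (r - ℓ + i)) u (by
      intro i hi j hj hij
      simp only [Set.mem_Iio] at hi hj
      have := hF.path.2.2.1 (show r - ℓ + i < r by omega) (show r - ℓ + j < r by omega) hij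
      omega) (by
      intro i hi j hj hij
      simp only [Set.mem_Iio] at hi hj
      exact hu.2.2.1 (show i < r' by omega) (show j < r' by omega) hij) (by
      intro i hi j hj
      exact hdis _ (by omega) _ (by omega)) ((range r).image v ∪ (range r').image u) (by
      refine le_trans ?_ hx
      have : ((range r).image v ∪ (range r').image u).card ≤ r + r' :=
        (card_union_le _ _).trans (Nat.add_le_add (card_image_le.trans (by simp)) (card_image_le.trans (by simp)))
      exact_mod_cast this)
  have hLk := hy1.1
  have hyv : ∀ i < r, ∀ j, ℓ ≤ j → j < L → v i ≠ y j := by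
    intro i hi j hj hjL he
    rcases Nat.lt_or_ge j (L - ℓ) with h | h
    · exact hy4 j hj h (by rw [← he]; exact mem_union_left _ (mem_image_of_mem _ (mem_range.2 hi)))
    · have h5 := hy3 (j - (L - ℓ)) (by omega)
      rw [show L - ℓ + (j - (L - ℓ)) = j by omega] at h5
      exact hdis i hi (j - (L-ℓ)) (by omega) (he.trans h5)
  have hF1 := hF.add hlk hy1 hy2 hyv
  have hov : ∀ i < ℓ, u i = glue r ℓ v y (r + L - ℓ - ℓ + i) := by
    intro i hi
    rw [glue_last (by omega) (by omega) hy2, hy3 i hi]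
  have him := image_glue (v := v) (w := y) (r := r) (r' := L) (ℓ := ℓ) (by omega) (by omega) hy2
  have hdis2 : ∀ i < r + L - ℓ, ∀ j, ℓ ≤ j → j < r' → glue r ℓ v y i ≠ u j := by
    intro i hi j hj hjr he
    rcases Nat.lt_or_ge i r with h | h
    · rw [glue_left h] at he
      exact hdis i h j hjr he
    · rw [glue_right (by omega) hy2 (by omega)] at he
      rcases Nat.lt_or_ge (i - (r - ℓ)) (L - ℓ) with h2 | h2
      · exact hy4 _ (by omega) h2 (by rw [he]; exact mem_union_right _ (mem_image_of_mem _ (mem_range.2 hjr)))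
      · have h5 := hy3 (i - (r - ℓ) - (L - ℓ)) (by omega)
        rw [show L - ℓ + (i - (r - ℓ) - (L - ℓ)) = i - (r - ℓ) by omega, he] at h5
        have := hu.2.2.1 (show j < r' by omega) (show i - (r - ℓ) - (L - ℓ) < r' by omega) h5
        omega
  have him2 := image_glue (v := glue r ℓ v y) (w := u) (r := r + L - ℓ) (r' := r') (ℓ := ℓ) (by omega) (by omega) hov
  refine ⟨r + L - ℓ + r' - ℓ, glue (r + L - ℓ) ℓ (glue r ℓ v y) u, by omega, ?_, ?_, hF1.add hlk hu hov hdis2, ?_⟩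
  · rw [him2, him]
    exact subset_union_left.trans subset_union_left
  · rw [him2]; exact subset_union_right
  · rintro rfl
    exact hF1.addAbs hlk hu hov hdis2

lemma edge_path {n k ℓ : ℕ} {H : Finset (Finset (Fin n))} (hlk : ℓ + 2 ≤ k) (hH : IsKGraph n k H)
    {y : ℝ} (hd : MinDegreeGe n k H y) (W : Finset (Fin n)) (hW1 : (W.card : ℝ) + k ≤ n)
    (hW2 : (W.card : ℝ) + k ≤ y) (x : Fin n) (hx : x ∉ W) :
    ∃ u : ℕ → Fin n, IsPathSeq k ℓ k (· ∈ H) u ∧ x ∈ (range k).image u ∧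
      ∀ j < k, u j ∉ W := by
  classical
  have h1 : W.card + k ≤ n := by exact_mod_cast hW1
  have hxW : {x} ⊆ Wᶜ := by simpa using hx
  obtain ⟨A, hA1, hA2, hA3⟩ := exists_subsuperset_card_eq (n := k - 1) hxW (by simp; omega) (by
    rw [card_compl, Fintype.card_fin]; omega)
  have hcd := codeg (by omega) hH hd hA3
  have hlt : W.card < (univ.filter (fun v => v ∉ A ∧ insert v A ∈ H)).card := by
    have h2 : (0:ℝ) < k := by exact_mod_cast (by omega : 0 < k)
    have : (W.card : ℝ) < ((univ.filter (fun v => v ∉ A ∧ insert v A ∈ H)).card : ℝ) := by linarith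
    exact_mod_cast this
  obtain ⟨z, hz, hzW⟩ := exists_mem_notMem_of_card_lt_card hlt
  obtain ⟨-, hzA, hzH⟩ := mem_filter.1 hz
  have hec : (insert z A).card = k := hH _ hzH
  set e := (insert z A).equivFinOfCardEq hec with he
  set u : ℕ → Fin n := fun i => if h : i < k then (e.symm ⟨i, h⟩ : Fin n) else x with hu
  have huim : (range k).image u = insert z A := by
    ext a
    simp only [mem_image, mem_range]
    constructor
    · rintro ⟨i, hi, rfl⟩
      simp only [hu, hi, dif_pos]
      exact (e.symm ⟨i, hi⟩).2
    · intro ha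
      refine ⟨e ⟨a, ha⟩, (e ⟨a, ha⟩).2, ?_⟩
      simp [hu]
  refine ⟨u, ⟨le_rfl, by simp, ?_, ?_⟩, ?_, ?_⟩
  · intro a ha b hb hab
    simp only [Set.mem_Iio] at ha hb
    simp only [hu, ha, hb, dif_pos] at hab
    have := e.symm.injective (Subtype.ext hab)
    simpa using this
  · intro s hs
    have : s * (k-ℓ) = 0 := by omega
    simp only [pathEdge, this, Nat.zero_add]
    rw [huim]; exact hzH
  · rw [huim]; exact mem_insert_of_mem (hA1 (mem_singleton_self x))
  · intro j hj hjW
    have : u j ∈ insert z A := by rw [← huim]; exact mem_image_of_mem _ (mem_range.2 hj)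
    rcases mem_insert.1 this with h | h
    · rw [h] at hjW; exact hzW hjW
    · exact (mem_compl.1 (hA2 h)) hjW

end AbsPath

open Finset
namespace AbsPath

lemma absorbing_congr {n k ℓ b : ℕ} {H : Finset (Finset (Fin n))} (hlk : ℓ < k)
    {S : Finset (Fin n)} {u u' : ℕ → Fin n} (h : ∀ i < b, u i = u' i)
    (ha : IsAbsorbingSeq n k ℓ b H S u) : IsAbsorbingSeq n k ℓ b H S u' := by
  obtain ⟨⟨h1, h2, h3, h4⟩, h5, w, h6, h7, h8, h9⟩ := ha
  have him : (range b).image u' = (range b).image u :=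
    image_congr (fun i hi => (h i (by simpa using hi)).symm)
  refine ⟨⟨h1, h2, ?_, ?_⟩, ?_, w, h6, ?_, ?_, ?_⟩
  · intro i hi j hj hij
    rw [← h i hi, ← h j hj] at hij
    exact h3 hi hj hij
  · intro s hs
    have : pathEdge k ℓ u' s = pathEdge k ℓ u s := by
      unfold pathEdge
      refine image_congr (fun i hi => ?_)
      have : i < k := by simpa using hi
      exact (h _ (by omega)).symm
    rw [this]; exact h4 s hs
  · intro i hi; rw [← h i hi]; exact h5 i hi
  · rw [him]; exact h7
  · intro i hi; rw [h8 i hi]; exact h i (by omega)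
  · intro i hi; rw [h9 i hi]; exact h _ (by omega)

/-- extension of a finite sequence -/
def lift {n b : ℕ} (hb : 0 < b) (ω : Fin b → Fin n) (i : ℕ) : Fin n :=
  if h : i < b then ω ⟨i, h⟩ else ω ⟨0, hb⟩

lemma lift_of_lt {n b : ℕ} (hb : 0 < b) (ω : Fin b → Fin n) {i : ℕ} (h : i < b) :
    lift hb ω i = ω ⟨i, h⟩ := by simp [lift, h]

lemma cgood_card {n k ℓ b : ℕ} {H : Finset (Finset (Fin n))} (hlk : ℓ < k) (hb : 0 < b) {c : ℝ}
    {S : Finset (Fin n)} (hS : CGood n k ℓ b H c S) :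
    c * (n : ℝ) ^ b ≤ Nat.card {ω : Fin b → Fin n // IsAbsorbingSeq n k ℓ b H S (lift hb ω)} := by
  classical
  unfold CGood at hS
  refine hS.trans ?_
  rw [Nat.card_eq_fintype_card, Fintype.card_subtype]
  norm_cast
  apply card_le_card
  intro ω hω
  simp only [mem_filter, mem_univ, true_and] at hω ⊢
  obtain ⟨u, hu, ha⟩ := hω
  refine absorbing_congr hlk (fun i hi => ?_) ha
  rw [lift_of_lt hb ω hi, ← hu ⟨i, hi⟩]

open scoped Classical in
lemma select {n b : ℕ} {T : Type} (hb : 0 < b) (hn : 0 < n) (Good : Finset T)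
    (A : T → (Fin b → Fin n) → Prop) (wt : T → ℝ) (hwt : ∀ S ∈ Good, 0 < wt S)
    (W : Finset (Fin n)) (c : ℝ) (hc : 0 < c)
    (hG : ∀ S ∈ Good, c * (n : ℝ) ^ b ≤ Nat.card {ω : Fin b → Fin n // A S ω})
    (hW : (b : ℝ) ^ 2 + b * W.card ≤ c / 2 * n) (hne : Good.Nonempty) :
    ∃ ω : Fin b → Fin n, Function.Injective ω ∧ (∀ i, ω i ∉ W) ∧ (∃ S ∈ Good, A S ω) ∧
      c / 2 * (∑ S ∈ Good, wt S) ≤ ∑ S ∈ Good, (if A S ω then wt S else 0) := by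
  have hn' : (0 : ℝ) < n := by exact_mod_cast hn
  have hΦ : 0 < ∑ S ∈ Good, wt S := sum_pos hwt hne
  set Ω : Finset (Fin b → Fin n) :=
    univ.filter (fun ω => Function.Injective ω ∧ ∀ i, ω i ∉ W) with hΩ
  have key : ∀ S ∈ Good, c / 2 * (n : ℝ) ^ b ≤ ((Ω.filter (fun ω => A S ω)).card : ℝ) := by
    intro S hS
    have h1 := good_maps W (A S) (hG S hS)
    rw [Nat.card_eq_fintype_card, Fintype.card_subtype] at h1
    simp only [Fintype.card_fin] at h1
    have h2 : (univ.filter (fun g : Fin b → Fin n => A S g ∧ Function.Injective g ∧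
        ∀ i, g i ∉ W)) = Ω.filter (fun ω => A S ω) := by
      ext ω; simp [hΩ]; tauto
    rw [h2] at h1
    refine le_trans ?_ h1
    have h3 : (n : ℝ) ^ b = n * (n : ℝ) ^ (b - 1) := by
      rw [← pow_succ', Nat.sub_add_cancel hb]
    have h4 := mul_le_mul_of_nonneg_right hW (by positivity : (0:ℝ) ≤ (n:ℝ) ^ (b-1))
    rw [h3]; nlinarith
  have hsum : ∑ ω ∈ Ω, c / 2 * (∑ S ∈ Good, wt S) ≤
      ∑ ω ∈ Ω, ∑ S ∈ Good, (if A S ω then wt S else 0) := by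
    rw [sum_comm]
    have h1 : ∀ S ∈ Good, wt S * (c / 2 * (n : ℝ) ^ b) ≤
        ∑ ω ∈ Ω, (if A S ω then wt S else 0) := by
      intro S hS
      rw [← sum_filter, sum_const, nsmul_eq_mul, mul_comm]
      exact mul_le_mul_of_nonneg_right (key S hS) (hwt S hS).le
    refine le_trans ?_ (sum_le_sum h1)
    have h0 : ∑ S ∈ Good, wt S * (c / 2 * (n : ℝ) ^ b) = (∑ S ∈ Good, wt S) * (c / 2 * (n : ℝ) ^ b) :=
      (sum_mul _ _ _).symm
    rw [h0, sum_const, nsmul_eq_mul]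
    have h2 : (Ω.card : ℝ) ≤ (n : ℝ) ^ b := by
      have : Ω.card ≤ n ^ b := by
        calc Ω.card ≤ Fintype.card (Fin b → Fin n) := card_le_univ _
          _ = n ^ b := by simp
      exact_mod_cast this
    have := mul_le_mul_of_nonneg_right h2 (by positivity : 0 ≤ c / 2 * ∑ S ∈ Good, wt S)
    nlinarith
  have hΩne : Ω.Nonempty := by
    obtain ⟨S, hS⟩ := hne
    have h1 := key S hS
    have h2 : (0 : ℝ) < ((Ω.filter (fun ω => A S ω)).card : ℝ) :=
      lt_of_lt_of_le (by positivity) h1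
    have h3 : 0 < (Ω.filter (fun ω => A S ω)).card := by exact_mod_cast h2
    exact (card_pos.mp h3).mono (filter_subset _ _)
  obtain ⟨ω, hω, hle⟩ := exists_le_of_sum_le hΩne hsum
  rw [hΩ, mem_filter] at hω
  refine ⟨ω, hω.2.1, hω.2.2, ?_, hle⟩
  by_contra hcon
  push Not at hcon
  have hz : ∑ S ∈ Good, (if A S ω then wt S else 0) = 0 :=
    sum_eq_zero (fun S hS => by rw [if_neg (hcon S hS)])
  rw [hz] at hle
  have : 0 < c / 2 * ∑ S ∈ Good, wt S := by positivity
  linarith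

open scoped Classical in
/-- number of absorbers -/
noncomputable def nabs (n k ℓ b : ℕ) (H : Finset (Finset (Fin n))) (t : ℕ) (g : ℕ → ℕ → Fin n)
    (S : Finset (Fin n)) : ℕ :=
  ((range t).filter (fun i => IsAbsorbingSeq n k ℓ b H S (g i))).card

open scoped Classical in
lemma nabs_succ {n k ℓ b : ℕ} {H : Finset (Finset (Fin n))} {t : ℕ} {g : ℕ → ℕ → Fin n}
    {S : Finset (Fin n)} (u : ℕ → Fin n) :
    nabs n k ℓ b H (t+1) (Function.update g t u) S =
      nabs n k ℓ b H t g S + if IsAbsorbingSeq n k ℓ b H S u then 1 else 0 := by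
  unfold nabs
  have h : (range t).filter (fun i => IsAbsorbingSeq n k ℓ b H S (Function.update g t u i)) =
      (range t).filter (fun i => IsAbsorbingSeq n k ℓ b H S (g i)) := by
    apply filter_congr
    intro i hi
    have : i ≠ t := by have := mem_range.mp hi; omega
    rw [Function.update_of_ne this]
  rw [range_add_one, filter_insert, h]
  simp only [Function.update_self]
  split_ifs
  · rw [card_insert_of_notMem (by simp)]
  · simp

lemma phaseA {n k ℓ b L : ℕ} {H : Finset (Finset (Fin n))} (hlk : ℓ < k) (hL : 2 * ℓ ≤ L)
    (hb : 0 < b) (hn : 0 < n) {x : ℝ} (hC : Conn n k ℓ L H x) (Good : Finset (Finset (Fin n)))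
    (c : ℝ) (hc : 0 < c) (hc1 : c ≤ 1) (hG : ∀ S ∈ Good, CGood n k ℓ b H c S)
    (hne : Good.Nonempty) (r0 : ℕ) (v0 : ℕ → Fin n) (hv0 : IsPathSeq k ℓ r0 (· ∈ H) v0) (M : ℕ)
    (hx : (r0 : ℝ) + M * (L + b) + b ≤ x)
    (hs : (b : ℝ) ^ 2 + b * (r0 + M * (L + b)) ≤ c / 2 * n) :
    ∀ t ≤ M, ∃ r v g, Flex n k ℓ b H r v t g ∧ r ≤ r0 + t * (L + b) ∧
      ∑ S ∈ Good, ((1 : ℝ) / 2) ^ (nabs n k ℓ b H t g S) ≤ (1 - c / 4) ^ t * Good.card := by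
  classical
  intro t
  induction t with
  | zero =>
    intro _
    refine ⟨r0, v0, fun _ _ => ⟨0, hn⟩, flex_zero hv0, by simp, ?_⟩
    simp [nabs]
  | succ t ih =>
    intro ht
    obtain ⟨r, v, g, hF, hr, hΦ⟩ := ih (by omega)
    have hr' : (r : ℝ) ≤ r0 + M * (L + b) := by
      have : r ≤ r0 + M * (L + b) := hr.trans (by gcongr; omega)
      exact_mod_cast this
    have hW : (((range r).image v).card : ℝ) ≤ r := by
      have : ((range r).image v).card ≤ r := by simpa using card_image_le (s := range r) (f := v)
      exact_mod_cast this
    obtain ⟨ω, hinj, hav, ⟨S0, hS0, habs⟩, hsum⟩ := select hb hn Good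
      (fun S ω => IsAbsorbingSeq n k ℓ b H S (lift hb ω))
      (fun S => ((1 : ℝ) / 2) ^ (nabs n k ℓ b H t g S)) (fun _ _ => by positivity)
      ((range r).image v) c hc (fun S hS => cgood_card hlk hb (hG S hS))
      (by
        refine le_trans ?_ hs
        gcongr
        exact hW.trans hr') hne
    obtain ⟨r2, v2, h1, -, -, -, h5⟩ := Flex.step hlk hL hF habs.1 hC (by linarith) (by
      intro i hi j hj heq
      rw [lift_of_lt hb ω hj] at heq
      exact hav ⟨j, hj⟩ (heq ▸ mem_image_of_mem v (mem_range.mpr hi)))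
    refine ⟨r2, v2, _, h5 rfl, ?_, ?_⟩
    · have : (t + 1) * (L + b) = t * (L + b) + L + b := by ring
      omega
    · have h6 : ∀ S ∈ Good, ((1 : ℝ) / 2) ^ (nabs n k ℓ b H (t+1)
          (Function.update g t (lift hb ω)) S) = ((1 : ℝ) / 2) ^ (nabs n k ℓ b H t g S) -
          1 / 2 * (if IsAbsorbingSeq n k ℓ b H S (lift hb ω) then
            ((1 : ℝ) / 2) ^ (nabs n k ℓ b H t g S) else 0) := by
        intro S _
        rw [nabs_succ]
        split_ifs
        · rw [pow_succ]; ring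
        · simp
      rw [sum_congr rfl h6, sum_sub_distrib, ← mul_sum, pow_succ]
      have h7 := mul_le_mul_of_nonneg_left hΦ (by linarith : 0 ≤ 1 - c / 4)
      nlinarith

lemma phaseB {n k ℓ b L : ℕ} {H : Finset (Finset (Fin n))} (hlk : ℓ + 2 ≤ k) (hL : 2 * ℓ ≤ L)
    (hH : IsKGraph n k H) {y : ℝ} (hd : MinDegreeGe n k H y)
    {x : ℝ} (hC : Conn n k ℓ L H x) {r0 t : ℕ} {v0 : ℕ → Fin n} {g : ℕ → ℕ → Fin n}
    (hF0 : Flex n k ℓ b H r0 v0 t g) (X : Finset (Fin n)) :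
    (r0 : ℝ) + X.card * (L + k) + k ≤ x → (r0 : ℝ) + X.card * (L + k) + k ≤ y →
    (r0 : ℝ) + X.card * (L + k) + k ≤ n →
    ∃ r v, Flex n k ℓ b H r v t g ∧ r ≤ r0 + X.card * (L + k) ∧ X ⊆ (range r).image v := by
  classical
  induction X using Finset.induction_on with
  | empty => intro _ _ _; exact ⟨r0, v0, hF0, by simp, by simp⟩
  | insert a X ha ih =>
    intro hx hy hn
    rw [card_insert_of_notMem ha] at *
    push_cast at hx hy hn
    have hp : (0 : ℝ) ≤ (L : ℝ) + k := by positivity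
    obtain ⟨r, v, hF, hr, hX⟩ := ih (by linarith) (by linarith) (by linarith)
    have hr' : (r : ℝ) ≤ r0 + X.card * (L + k) := by exact_mod_cast hr
    have hr2 : r0 + (X.card + 1) * (L + k) = r0 + X.card * (L + k) + L + k := by ring
    by_cases hav : a ∈ (range r).image v
    · exact ⟨r, v, hF, by omega, insert_subset hav hX⟩
    have hW : (((range r).image v).card : ℝ) ≤ r := by
      have : ((range r).image v).card ≤ r := by simpa using card_image_le (s := range r) (f := v)
      exact_mod_cast this
    obtain ⟨u, hu, hau, hdis⟩ := edge_path hlk hH hd ((range r).image v) (by linarith)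
      (by linarith) a hav
    obtain ⟨r2, v2, h1, h2, h3, h4, -⟩ := Flex.step (by omega) hL hF hu hC (by linarith) (by
      intro i hi j hj heq
      exact hdis j hj (heq ▸ mem_image_of_mem v (mem_range.mpr hi)))
    exact ⟨r2, v2, h4, by omega, insert_subset (h3 hau) (hX.trans h2)⟩

lemma prop2 {n k ℓ b : ℕ} {H : Finset (Finset (Fin n))} {r t : ℕ} {v : ℕ → Fin n}
    {g : ℕ → ℕ → Fin n} (hF : Flex n k ℓ b H r v t g) (𝒮 : Finset (Finset (Fin n)))
    (hX : ∀ S ∈ 𝒮, 𝒮.card ≤ nabs n k ℓ b H t g S)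
    (hd : ∀ S ∈ 𝒮, Disjoint S ((range r).image v))
    (hp : ∀ S ∈ 𝒮, ∀ T ∈ 𝒮, S ≠ T → Disjoint S T) :
    ∃ w : ℕ → Fin n,
      IsPathSeq k ℓ (r + (k - ℓ) * 𝒮.card) (· ∈ H) w ∧
      (range (r + (k - ℓ) * 𝒮.card)).image w = (range r).image v ∪ 𝒮.biUnion id ∧
      (∀ i < ℓ, w i = v i) ∧ (∀ i < ℓ, w (r + (k - ℓ) * 𝒮.card - ℓ + i) = v (r - ℓ + i)) := by
  classical
  obtain ⟨f, hf, hfm⟩ := (Finset.all_card_le_biUnion_card_iff_exists_injective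
    (fun S : 𝒮 => (range t).filter (fun i => IsAbsorbingSeq n k ℓ b H S.1 (g i)))).mp (by
      intro s
      rcases s.eq_empty_or_nonempty with rfl | ⟨S, hS⟩
      · simp
      · have h1 : s.card ≤ 𝒮.card := by simpa using card_le_univ s
        refine h1.trans ((hX S.1 S.2).trans ?_)
        unfold nabs
        convert card_le_card (subset_biUnion_of_mem
          (fun S : 𝒮 => (range t).filter (fun i => IsAbsorbingSeq n k ℓ b H S.1 (g i))) hS))
  set I : Finset ℕ := univ.image f with hI
  have hIc : I.card = 𝒮.card := by rw [hI, card_image_of_injective _ hf]; simp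
  set S' : ℕ → Finset (Fin n) := fun i => if h : ∃ S, f S = i then (h.choose).1 else ∅ with hS'
  have hS'f : ∀ S, S' (f S) = S.1 := by
    intro S
    have h : ∃ T, f T = f S := ⟨S, rfl⟩
    simp only [hS', dif_pos h]
    rw [hf h.choose_spec]
  obtain ⟨w, h1, h2, h3, h4⟩ := hF.flex I (by
      intro i hi
      obtain ⟨S, -, rfl⟩ := mem_image.mp hi
      exact (mem_filter.mp (hfm S)).1) S' (by
      intro i hi
      obtain ⟨S, -, rfl⟩ := mem_image.mp hi
      rw [hS'f]
      exact ⟨(mem_filter.mp (hfm S)).2, hd _ S.2⟩) (by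
      intro i hi j hj hij
      obtain ⟨S, -, rfl⟩ := mem_image.mp hi
      obtain ⟨T, -, rfl⟩ := mem_image.mp hj
      rw [hS'f, hS'f]
      exact hp _ S.2 _ T.2 (fun h => hij (by rw [Subtype.ext h])))
  have hU : I.biUnion S' = 𝒮.biUnion id := by
    ext x
    simp only [mem_biUnion, hI, mem_image, mem_univ, true_and, id]
    constructor
    · rintro ⟨_, ⟨S, rfl⟩, hx⟩
      rw [hS'f] at hx
      exact ⟨S.1, S.2, hx⟩
    · rintro ⟨S, hS, hx⟩
      exact ⟨f ⟨S, hS⟩, ⟨_, rfl⟩, by rw [hS'f]; exact hx⟩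
  rw [hIc] at h1 h2 h4
  rw [hU] at h2
  exact ⟨w, h1, h2, h3, h4⟩

open scoped Classical in
/-- vertices in many bad sets are few -/
lemma few_bad {n d : ℕ} (hn : 0 < n) (hd : 0 < d) (Bad : Finset (Fin n) → Prop) (γ γ' : ℝ)
    (h : (((univ.powersetCard d).filter (fun S => Bad S)).card : ℝ) ≤ γ' * (n : ℝ) ^ d) :
    γ * ((univ.filter (fun x : Fin n => ¬ ((((univ.powersetCard d).filter
      (fun S => x ∈ S ∧ Bad S)).card : ℝ) ≤ γ * (n : ℝ) ^ (d - 1)))).card : ℝ) ≤ d * γ' * n := by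
  set X := univ.filter (fun x : Fin n => ¬ ((((univ.powersetCard d).filter
      (fun S => x ∈ S ∧ Bad S)).card : ℝ) ≤ γ * (n : ℝ) ^ (d - 1))) with hX
  have hn' : (0 : ℝ) < n := by exact_mod_cast hn
  set B := (univ.powersetCard d).filter (fun S : Finset (Fin n) => Bad S) with hB
  have h1 : ∑ x ∈ X, γ * (n : ℝ) ^ (d - 1) ≤
      ∑ x ∈ X, ∑ S ∈ B, (if x ∈ S then (1 : ℝ) else 0) := by
    apply sum_le_sum
    intro x hx
    have h2 := (mem_filter.mp hx).2
    push Not at h2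
    refine h2.le.trans (le_of_eq ?_)
    rw [← sum_filter, sum_const, nsmul_eq_mul, mul_one, hB, filter_filter]
    congr 2
    ext S; simp; tauto
  rw [sum_comm, sum_const, nsmul_eq_mul] at h1
  have h3 : ∑ S ∈ B, ∑ x ∈ X, (if x ∈ S then (1 : ℝ) else 0) ≤ B.card * d := by
    rw [← nsmul_eq_mul, ← sum_const]
    apply sum_le_sum
    intro S hS
    rw [← sum_filter, sum_const, nsmul_eq_mul, mul_one]
    have h4 : S.card = d := (mem_powersetCard.mp (mem_filter.mp hS).1).2
    have : (X.filter (fun x => x ∈ S)).card ≤ d := by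
      rw [← h4]; exact card_le_card (fun x hx => (mem_filter.mp hx).2)
    exact_mod_cast this
  have h5 : (n : ℝ) ^ d = n * (n : ℝ) ^ (d - 1) := by rw [← pow_succ', Nat.sub_add_cancel hd]
  have h6 : (0 : ℝ) < (n : ℝ) ^ (d - 1) := by positivity
  have h7 : (B.card : ℝ) * d ≤ γ' * (n : ℝ) ^ d * d := by gcongr
  rw [h5] at h7
  have : (γ * X.card) * (n : ℝ) ^ (d - 1) ≤ (d * γ' * n) * (n : ℝ) ^ (d - 1) := by nlinarith
  exact le_of_mul_le_mul_right this h6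

/-- exponential beats polynomial -/
lemma exp_small (d : ℕ) (a : ℝ) (ha : 0 < a) :
    ∃ n1 : ℕ, ∀ n : ℕ, n1 ≤ n → (n : ℝ) ^ d * Real.exp (-(a * n)) < 1 := by
  have h1 := Real.tendsto_pow_mul_exp_neg_atTop_nhds_zero d
  have h2 : Filter.Tendsto (fun n : ℕ => a * (n : ℝ)) Filter.atTop Filter.atTop :=
    Filter.Tendsto.const_mul_atTop ha tendsto_natCast_atTop_atTop
  have h3 := (h1.comp h2).eventually (gt_mem_nhds (show (0:ℝ) < a ^ d by positivity))
  obtain ⟨n1, hn1⟩ := Filter.eventually_atTop.mp h3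
  refine ⟨n1, fun n hn => ?_⟩
  have := hn1 n hn
  simp only [Function.comp, mul_pow] at this
  have h4 : (0:ℝ) < a ^ d := by positivity
  have h5 : a ^ d * ((n : ℝ) ^ d * Real.exp (-(a * n))) < a ^ d * 1 := by nlinarith
  exact lt_of_mul_lt_mul_left h5 h4.le

lemma nabs_large {n k ℓ b d : ℕ} {H : Finset (Finset (Fin n))} {t : ℕ} {g : ℕ → ℕ → Fin n}
    {Good : Finset (Finset (Fin n))} {c β : ℝ} (hc : 0 < c) (hc1 : c ≤ 1)
    (ht : β * n ≤ t) (hcard : (Good.card : ℝ) ≤ (n : ℝ) ^ d)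
    (hsm : (n : ℝ) ^ d * Real.exp (-(c * β / 8 * n)) < 1)
    (hsum : ∑ S ∈ Good, ((1 : ℝ) / 2) ^ (nabs n k ℓ b H t g S) ≤ (1 - c / 4) ^ t * Good.card)
    {S : Finset (Fin n)} (hS : S ∈ Good) : c * β / 8 * n < nabs n k ℓ b H t g S := by
  by_contra hcon
  push Not at hcon
  have h1 : ((1 : ℝ) / 2) ^ (nabs n k ℓ b H t g S) ≤ (1 - c / 4) ^ t * Good.card :=
    (single_le_sum (f := fun S => ((1 : ℝ) / 2) ^ (nabs n k ℓ b H t g S))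
      (fun _ _ => by positivity) hS).trans hsum
  have h2 : Real.exp (-(c * β / 8 * n)) ≤ ((1 : ℝ) / 2) ^ (nabs n k ℓ b H t g S) := by
    have : Real.exp (-1) ≤ 1 / 2 := by
      rw [Real.exp_neg, inv_eq_one_div]
      apply one_div_le_one_div_of_le (by norm_num)
      have := Real.add_one_le_exp (1:ℝ)
      linarith
    calc Real.exp (-(c * β / 8 * n)) ≤ Real.exp ((nabs n k ℓ b H t g S : ℕ) * (-1)) := by
          apply Real.exp_le_exp.mpr; linarith
      _ = Real.exp (-1) ^ (nabs n k ℓ b H t g S) := Real.exp_nat_mul _ _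
      _ ≤ _ := by gcongr
  have h3 : (1 - c / 4) ^ t ≤ Real.exp (-(c * β / 4 * n)) := by
    calc (1 - c / 4) ^ t ≤ Real.exp (-(c/4)) ^ t := by
          have := Real.add_one_le_exp (-(c/4))
          gcongr <;> linarith
      _ = Real.exp (t * (-(c/4))) := (Real.exp_nat_mul _ _).symm
      _ ≤ _ := by apply Real.exp_le_exp.mpr; nlinarith
  have h4 : Real.exp (-(c * β / 4 * n)) =
      Real.exp (-(c * β / 8 * n)) * Real.exp (-(c * β / 8 * n)) := by
    rw [← Real.exp_add]; congr 1; ring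
  have h5 : (1 - c / 4) ^ t * Good.card ≤ Real.exp (-(c * β / 4 * n)) * (n : ℝ) ^ d := by
    gcongr
  have h6 := Real.exp_pos (-(c * β / 8 * n))
  rw [h4] at h5
  nlinarith

end AbsPath

open Finset
namespace AbsPath

open scoped Classical in
lemma main_one {n k ℓ b L : ℕ} {H : Finset (Finset (Fin n))} (hlk : ℓ + 2 ≤ k) (hL : 2 * ℓ ≤ L)
    (hb : 0 < b) (hn : 0 < n) (hH : IsKGraph n k H) {y x : ℝ} (hd : MinDegreeGe n k H y)
    (hC : Conn n k ℓ L H x) (c β : ℝ) (hc : 0 < c) (hc1 : c ≤ 1) (M m : ℕ)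
    (hM : β * n ≤ M) (Xs : Finset (Fin n)) (hXs : Xs.card ≤ m)
    (hs : (b : ℝ) ^ 2 + b * (k + M * (L + b)) ≤ c / 2 * n)
    (h1 : (k : ℝ) + M * (L + b) + m * (L + k) + k + b ≤ x)
    (h2 : (k : ℝ) + M * (L + b) + m * (L + k) + k + b ≤ y)
    (h3 : (k : ℝ) + M * (L + b) + m * (L + k) + k + b ≤ n)
    (hsm : (n : ℝ) ^ (k - ℓ) * Real.exp (-(c * β / 8 * n)) < 1) :
    ∃ r v t g, Flex n k ℓ b H r v t g ∧ r ≤ k + M * (L + b) + m * (L + k) ∧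
      Xs ⊆ (range r).image v ∧
      ∀ S : Finset (Fin n), S.card = k - ℓ → CGood n k ℓ b H c S →
        c * β / 8 * n < nabs n k ℓ b H t g S := by
  have p1 : (0 : ℝ) ≤ M * (L + b) := by positivity
  have p2 : (0 : ℝ) ≤ m * (L + k) := by positivity
  have p3 : (0 : ℝ) ≤ b := by positivity
  have p4 : (0 : ℝ) ≤ k := by positivity
  have p5 : (Xs.card : ℝ) * (L + k) ≤ m * (L + k) := by
    have : (Xs.card : ℝ) ≤ m := by exact_mod_cast hXs
    gcongr
  obtain ⟨v0, hv0, -, -⟩ := edge_path hlk hH hd ∅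
    (by rw [card_empty, Nat.cast_zero]; linarith) (by rw [card_empty, Nat.cast_zero]; linarith)
    ⟨0, hn⟩ (by simp)
  set Good := (univ.powersetCard (k - ℓ)).filter (fun S => CGood n k ℓ b H c S) with hGood
  have hGc : (Good.card : ℝ) ≤ (n : ℝ) ^ (k - ℓ) := by
    have : Good.card ≤ n ^ (k - ℓ) := by
      refine (card_le_card (filter_subset _ _)).trans ?_
      rw [card_powersetCard, card_univ, Fintype.card_fin]
      exact Nat.choose_le_pow _ _
    exact_mod_cast this
  have hA : ∃ r v t g, Flex n k ℓ b H r v t g ∧ r ≤ k + M * (L + b) ∧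
      ∀ S ∈ Good, c * β / 8 * n < nabs n k ℓ b H t g S := by
    rcases Good.eq_empty_or_nonempty with he | hne
    · refine ⟨k, v0, 0, fun _ _ => ⟨0, hn⟩, flex_zero hv0, by omega, ?_⟩
      rw [he]; simp
    · obtain ⟨r, v, g, hF, hr, hsum⟩ := phaseA (by omega) hL hb hn hC Good c hc hc1
        (fun S hS => (mem_filter.mp hS).2) hne k v0 hv0 M (by linarith) hs M le_rfl
      exact ⟨r, v, M, g, hF, hr, fun S hS => nabs_large hc hc1 hM hGc hsm hsum hS⟩
  obtain ⟨r, v, t, g, hF, hr, hab⟩ := hA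
  have hr' : (r : ℝ) ≤ k + M * (L + b) := by exact_mod_cast hr
  obtain ⟨r2, v2, hF2, hr2, hX2⟩ := phaseB hlk hL hH hd hC hF Xs (by linarith) (by linarith)
    (by linarith)
  refine ⟨r2, v2, t, g, hF2, ?_, hX2, ?_⟩
  · have : Xs.card * (L + k) ≤ m * (L + k) := Nat.mul_le_mul_right _ hXs
    omega
  · intro S hS hSg
    exact hab S (mem_filter.mpr ⟨mem_powersetCard.mpr ⟨subset_univ _, hS⟩, hSg⟩)

end AbsPath

set_option maxHeartbeats 1000000 in
open AbsPath in
open scoped Classical in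
/-- Absorbing path lemma: if `(k-ℓ) ∤ k`, any large `k`-graph `H` of minimum
degree at least `μn` contains an `ℓ`-path `P` on at most `μn` vertices such
that every vertex outside `P` lies in few `c`-bad `(k-ℓ)`-sets, and `P` can
absorb any collection of at most `αn` disjoint `c`-good `(k-ℓ)`-sets of
vertices of `H - V(P)`. -/
theorem absorbing_path_lemma
    (k ℓ : ℕ) (hk : 3 ≤ k) (hl1 : 1 ≤ ℓ) (hl2 : ℓ ≤ k - 1)
    (hnd : ¬ (k - ℓ) ∣ k) :
    ∃ b : ℕ, k ≤ b ∧ b ≤ k ^ 4 ∧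
      ∀ μ : ℝ, 0 < μ →
        ∃ α c γ : ℝ, 0 < α ∧ α < c ∧ c < γ ∧ γ < μ ∧
          ∃ n₀ : ℕ, ∀ n ≥ n₀,
            ∀ H : Finset (Finset (Fin n)), IsKGraph n k H →
              MinDegreeGe n k H (μ * n) →
              ∃ (rP : ℕ) (vP : ℕ → Fin n),
                (rP : ℝ) ≤ μ * n ∧
                IsPathSeq k ℓ rP (· ∈ H) vP ∧
                (∀ x : Fin n, x ∉ (Finset.range rP).image vP →
                  (((Finset.univ.powersetCard (k - ℓ)).filter
                      (fun S => x ∈ S ∧ ¬ CGood n k ℓ b H c S)).card : ℝ)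
                    ≤ γ * (n : ℝ) ^ (k - ℓ - 1)) ∧
                (∀ 𝒮 : Finset (Finset (Fin n)),
                  (𝒮.card : ℝ) ≤ α * n →
                  (∀ S ∈ 𝒮, S.card = k - ℓ ∧ CGood n k ℓ b H c S ∧
                    Disjoint S ((Finset.range rP).image vP)) →
                  (∀ S ∈ 𝒮, ∀ T ∈ 𝒮, S ≠ T → Disjoint S T) →
                  ∃ w : ℕ → Fin n,
                    IsPathSeq k ℓ (rP + (k - ℓ) * 𝒮.card) (· ∈ H) w ∧
                    (Finset.range (rP + (k - ℓ) * 𝒮.card)).image w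
                      = (Finset.range rP).image vP ∪ 𝒮.biUnion id ∧
                    (∀ i < ℓ, w i = vP i) ∧
                    (∀ i < ℓ,
                      w (rP + (k - ℓ) * 𝒮.card - ℓ + i) = vP (rP - ℓ + i))) := by
  have hlk : ℓ + 2 ≤ k := by
    by_contra h
    have : k - ℓ = 1 := by omega
    rw [this] at hnd
    exact hnd (one_dvd k)
  have hkb : k ≤ bb k ℓ := by unfold bb; exact Nat.le_add_right _ _
  refine ⟨bb k ℓ, hkb, bb_le hl1 (by omega), ?_⟩
  intro μ hμ
  obtain ⟨L, hkL, hL, hcon⟩ := connect hl1 hlk hnd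
  obtain ⟨ε, hε, n1, hn1⟩ := hcon μ hμ
  set γ : ℝ := μ / 2 with hγ
  set θ : ℝ := min ε (min μ 1) with hθ
  have hθ0 : 0 < θ := by positivity
  have hθε : θ ≤ ε := min_le_left _ _
  have hθμ : θ ≤ μ := (min_le_right _ _).trans (min_le_left _ _)
  have hθ1 : θ ≤ 1 := (min_le_right _ _).trans (min_le_right _ _)
  have hd0 : (0 : ℝ) < ((k - ℓ : ℕ) : ℝ) := by exact_mod_cast (by omega : 0 < k - ℓ)
  have hk0 : (3 : ℝ) ≤ k := by exact_mod_cast hk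
  have hLk0 : (0 : ℝ) < (L : ℝ) + k := by positivity
  have hγ0 : 0 < γ := by positivity
  set γ' : ℝ := γ * θ / (4 * ((k - ℓ : ℕ) : ℝ) * (L + k)) with hγ'
  have hγ'0 : 0 < γ' := by positivity
  obtain ⟨c0, hc0, n2, hn2⟩ := most_good hl1 hlk hnd μ γ' hμ hγ'0
  set c : ℝ := min (min c0 (μ / 4)) 1 with hc
  have hcpos : 0 < c := by positivity
  have hcc0 : c ≤ c0 := (min_le_left _ _).trans (min_le_left _ _)
  have hcμ : c ≤ μ / 4 := (min_le_left _ _).trans (min_le_right _ _)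
  have hc1 : c ≤ 1 := min_le_right _ _
  obtain ⟨b, hb⟩ : ∃ b, b = bb k ℓ := ⟨_, rfl⟩
  rw [← hb] at hn2 hkb ⊢
  have hb0 : 0 < b := by omega
  have hbR : (1 : ℝ) ≤ b := by exact_mod_cast hb0
  have hLb : (1 : ℝ) ≤ (L : ℝ) + b := by
    have : (0 : ℝ) ≤ L := by positivity
    linarith
  set β : ℝ := c * θ / (8 * b * (L + b)) with hβ
  have hβ0 : 0 < β := by positivity
  have hβe : b * ((L + b) * β) = c * θ / 8 := by
    rw [hβ]; field_simp
  have hβ2 : (L + b) * β ≤ c * θ / 8 := by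
    rw [← hβe]
    have : 0 ≤ ((L : ℝ) + b) * β := by positivity
    nlinarith
  have hcθ : c * θ ≤ c := mul_le_of_le_one_right hcpos.le hθ1
  have hcθ2 : c * θ ≤ θ := mul_le_of_le_one_left hθ0.le hc1
  have hβ1 : β ≤ 1 / 8 := by nlinarith
  refine ⟨c * β / 8, c, γ, by positivity, by nlinarith, by rw [hγ]; linarith, by rw [hγ]; linarith,
    ?_⟩
  obtain ⟨n3, hn3⟩ := exists_big (c * θ / 8)
    ((b : ℝ) ^ 2 + b * k + b * (L + b) + 2 * k + b) (by positivity)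
  obtain ⟨n4, hn4⟩ := exp_small (k - ℓ) (c * β / 8) (by positivity)
  refine ⟨max (max n1 n2) (max (max n3 n4) 1), ?_⟩
  intro n hn H hH hdeg
  have hn0 : 0 < n := by omega
  have hnR : (0 : ℝ) < n := by exact_mod_cast hn0
  have hK := hn3 n (by omega)
  have hC : Conn n k ℓ L H (ε * n) := hn1 n (by omega) H hH hdeg
  have hbad := hn2 c hcpos.le hcc0 n (by omega) H hH hdeg
  have hXb := few_bad hn0 (by omega : 0 < k - ℓ) (fun S => ¬ CGood n k ℓ b H c S) γ γ' (by convert hbad)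
  obtain ⟨Xs, hXs⟩ : ∃ Xs, Xs = (univ.filter (fun x : Fin n => ¬ ((((univ.powersetCard (k-ℓ)).filter
      (fun S => x ∈ S ∧ ¬ CGood n k ℓ b H c S)).card : ℝ) ≤ γ * (n : ℝ) ^ (k - ℓ - 1)))) := ⟨_, rfl⟩
  have hXb' : γ * (Xs.card : ℝ) ≤ ((k - ℓ : ℕ) : ℝ) * γ' * n := by
    rw [hXs]; convert hXb
  have hXb2 : (Xs.card : ℝ) * (L + k) ≤ θ / 4 * n := by
    have e : ((k - ℓ : ℕ) : ℝ) * γ' * n * (L + k) = γ * (θ / 4 * n) := by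
      rw [hγ']; field_simp
    have h1 : γ * (Xs.card : ℝ) * (L + k) ≤ γ * (θ / 4 * n) := by
      rw [← e]
      exact mul_le_mul_of_nonneg_right hXb' hLk0.le
    rw [mul_assoc] at h1
    exact le_of_mul_le_mul_left h1 hγ0
  set M := ⌈β * n⌉₊ with hM
  have hM1 : β * n ≤ M := Nat.le_ceil _
  have hM2 : (M : ℝ) ≤ β * n + 1 := (Nat.ceil_lt_add_one (by positivity)).le
  have hM3 : (M : ℝ) * (L + b) ≤ c * θ / 8 * n + (L + b) := by
    have h1 := mul_le_mul_of_nonneg_right hM2 (by linarith : 0 ≤ (L : ℝ) + b)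
    have h2 := mul_le_mul_of_nonneg_right hβ2 hnR.le
    linarith
  have hM4 : b * ((M : ℝ) * (L + b)) ≤ c * θ / 8 * n + b * (L + b) := by
    have h1 := mul_le_mul_of_nonneg_right hM2 (by positivity : 0 ≤ (b : ℝ) * ((L : ℝ) + b))
    have h2 := congrArg (fun z => z * (n : ℝ)) hβe
    linarith
  have hcθn : c * θ * n ≤ c * n := by gcongr
  have hcθn2 : c * θ * n ≤ θ * n := by gcongr
  have hcn0 : 0 ≤ c * n := by positivity
  have hθn : 0 ≤ θ * n := by positivity
  have hbLb : (L : ℝ) + b ≤ b * (L + b) :=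
    le_mul_of_one_le_left (by linarith) hbR
  have hbig : (k : ℝ) + M * (L + b) + Xs.card * (L + k) + k + b ≤ θ * n := by
    have q1 : (0 : ℝ) ≤ (b : ℝ) ^ 2 := by positivity
    have q2 : (0 : ℝ) ≤ (b : ℝ) * k := by positivity
    linarith
  obtain ⟨r, v, t, g, hF, hr, hXv, hab⟩ := main_one hlk hL hb0 hn0 hH hdeg hC c β hcpos hc1 M
    Xs.card hM1 Xs le_rfl (by rw [mul_add]; linarith)
    (hbig.trans (by gcongr)) (hbig.trans (by gcongr))
    (hbig.trans (mul_le_of_le_one_left hnR.le hθ1)) (hn4 n (by omega))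
  refine ⟨r, v, ?_, hF.path, ?_, ?_⟩
  · have hr' : (r : ℝ) ≤ k + M * (L + b) + Xs.card * (L + k) := by exact_mod_cast hr
    have : θ * n ≤ μ * n := by gcongr
    linarith
  · intro x hx
    by_contra hcon2
    refine hx (hXv ?_)
    rw [hXs]
    exact mem_filter.mpr ⟨mem_univ _, hcon2⟩
  · intro 𝒮 h1 h2 h3
    refine prop2 hF 𝒮 ?_ (fun S hS => (h2 S hS).2.2) h3
    intro S hS
    have := hab S (h2 S hS).1 (h2 S hS).2.1
    have h5 : (𝒮.card : ℝ) ≤ nabs n k ℓ b H t g S := by linarith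
    exact_mod_cast h5
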